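/- The equation −Δ^{α/2}u = ρ·φ(u) admits a nonnegative entire bounded solution on ℝ^N if and only if sup_{x ∈ ℝ^N} ∫_{ℝ^N} ρ(y)·|x−y|^{-(N−α)} dy < ∞. -/

import Mathlib

open MeasureTheory Real Filter Topology
open scoped ENNReal

noncomputable section

/-- The constant `c_{N,-α} = 2^α · π^{-N/2} · Γ((N+α)/2) / |Γ(-α/2)|`. -/
def fracLapCoeff (N : ℕ) (α : ℝ) : ℝ :=
  2 ^ α * Real.pi ^ (-(N : ℝ) / 2) * Real.Gamma (((N : ℝ) + α) / 2) / |Real.Gamma (-α / 2)|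

/-- The fractional Laplacian `Δ^{α/2}θ` of a test function `θ`. -/
def fracLap (N : ℕ) (α : ℝ) (θ : EuclideanSpace ℝ (Fin N) → ℝ)
    (x : EuclideanSpace ℝ (Fin N)) : ℝ :=
  (fracLapCoeff N α / 2) *
    ∫ z : EuclideanSpace ℝ (Fin N), (θ (x + z) + θ (x - z) - 2 * θ x) / ‖z‖ ^ ((N : ℝ) + α)

/-- A nonnegative entire bounded (distributional) solution of `-Δ^{α/2}u = ρ·φ(u)` on
`ℝ^N`; here `φ : ℝ → ℝ≥0∞` is extended-real-valued (`φ(0)` may be `∞`), the local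
integrability of `ρ·φ(u)` is expressed via the lower integral. -/
def NegEntireSol (N : ℕ) (α : ℝ) (ρ : EuclideanSpace ℝ (Fin N) → ℝ) (φ : ℝ → ℝ≥0∞)
    (u : EuclideanSpace ℝ (Fin N) → ℝ) : Prop :=
  Continuous u ∧ (∃ M, ∀ x, u x ≤ M) ∧ (∀ x, 0 ≤ u x) ∧
  (∀ K : Set (EuclideanSpace ℝ (Fin N)), IsCompact K →
    (∫⁻ x in K, ENNReal.ofReal (ρ x) * φ (u x)) ≠ ⊤) ∧
  ∀ θ : EuclideanSpace ℝ (Fin N) → ℝ, ContDiff ℝ (⊤ : ℕ∞) θ → HasCompactSupport θ →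
    (∫ x, u x * fracLap N α θ x) =
      -∫ x, (ENNReal.ofReal (ρ x) * φ (u x)).toReal * θ x

local notation "𝔼" N:max => EuclideanSpace ℝ (Fin N)

/-- The symmetric second difference of `θ` at `x` in direction `z`. -/
def secondDiff {N : ℕ} (θ : 𝔼 N → ℝ) (x z : 𝔼 N) : ℝ := θ (x + z) + θ (x - z) - 2 * θ x

/-- The integrand in the definition of the fractional Laplacian. -/
def fracKernel {N : ℕ} (α : ℝ) (θ : 𝔼 N → ℝ) (x z : 𝔼 N) : ℝ :=
  secondDiff θ x z / ‖z‖ ^ ((N : ℝ) + α)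

lemma fracLap_eq {N : ℕ} (α : ℝ) (θ : 𝔼 N → ℝ) (x : 𝔼 N) :
    fracLap N α θ x = fracLapCoeff N α / 2 * ∫ z, fracKernel α θ x z := rfl

lemma fracLapCoeff_pos {N : ℕ} {α : ℝ} (hα1 : 0 < α) (hα2 : α < 2) : 0 < fracLapCoeff N α := by
  have h1 : 0 < Real.Gamma (((N : ℝ) + α) / 2) := Real.Gamma_pos_of_pos (by positivity)
  have h2 : Real.Gamma (-α / 2) ≠ 0 := by
    apply Real.Gamma_ne_zero
    intro m hm
    rcases Nat.eq_zero_or_pos m with rfl | h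
    · simp at hm; linarith
    · have : (1 : ℝ) ≤ m := by exact_mod_cast h
      linarith
  unfold fracLapCoeff
  have := abs_pos.2 h2
  have := Real.pi_pos
  positivity

lemma norm_symm_diff_le {E : Type*} [NormedAddCommGroup E] [NormedSpace ℝ E] {θ : E → ℝ}
    (hd : Differentiable ℝ θ) {L : NNReal} (hL : LipschitzWith L (fderiv ℝ θ)) (x z : E) :
    ‖θ (x + z) + θ (x - z) - (θ x + θ x)‖ ≤ 2 * L * ‖z‖ * ‖z‖ := by
  have key : ‖(θ (x + z) + θ (x - z)) - (θ (x + 0) + θ (x - 0))‖ ≤ (2 * L * ‖z‖) * ‖z - 0‖ := by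
    refine Convex.norm_image_sub_le_of_norm_hasFDerivWithin_le
      (f := fun w => θ (x + w) + θ (x - w)) (f' := fun w => fderiv ℝ θ (x + w) - fderiv ℝ θ (x - w))
      (s := Metric.closedBall 0 ‖z‖) ?_ ?_ (convex_closedBall _ _) (by simp) (by simp)
    · intro w _
      have h1 : HasFDerivAt (fun w => θ (x + w)) (fderiv ℝ θ (x + w)) w := by
        have := (hd (x + w)).hasFDerivAt.comp w ((hasFDerivAt_id w).const_add x)
        rwa [ContinuousLinearMap.comp_id] at this
      have h2 : HasFDerivAt (fun w => θ (x - w)) (-(fderiv ℝ θ (x - w))) w := by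
        have := (hd (x - w)).hasFDerivAt.comp w ((hasFDerivAt_id w).const_sub x)
        rwa [ContinuousLinearMap.comp_neg, ContinuousLinearMap.comp_id] at this
      have := h1.add h2
      rw [← sub_eq_add_neg] at this
      exact this.hasFDerivWithinAt
    · intro w hw
      have := hL.dist_le_mul (x + w) (x - w)
      rw [dist_eq_norm, dist_eq_norm] at this
      refine this.trans ?_
      have h3 : ‖x + w - (x - w)‖ ≤ 2 * ‖z‖ := by
        have : x + w - (x - w) = w + w := by abel
        rw [this]
        have := norm_add_le w w
        have : ‖w‖ ≤ ‖z‖ := by simpa using hw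
        linarith
      nlinarith [L.2, mul_le_mul_of_nonneg_left h3 L.2]
  simpa using key

lemma secondDiff_le {N : ℕ} {θ : 𝔼 N → ℝ} (hθ : ContDiff ℝ (⊤ : ℕ∞) θ)
    (hc : HasCompactSupport θ) : ∃ C, 0 ≤ C ∧ ∀ x z, |secondDiff θ x z| ≤ C * min 1 (‖z‖ ^ 2) := by
  obtain ⟨B, hB⟩ := hc.exists_bound_of_continuous hθ.continuous
  have hB0 : 0 ≤ B := (norm_nonneg _).trans (hB 0)
  obtain ⟨L, hL⟩ := ContDiff.lipschitzWith_of_hasCompactSupport (𝕂 := ℝ) (n := 1)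
    (hc.fderiv ℝ) (hθ.fderiv_right (m := 1) (by norm_cast)) (by norm_num)
  have hd : Differentiable ℝ θ := hθ.differentiable (by simp)
  refine ⟨max (4 * B) (2 * L), by positivity, fun x z => ?_⟩
  rcases le_total 1 (‖z‖ ^ 2) with h | h
  · rw [min_eq_left h, mul_one]
    refine le_trans ?_ (le_max_left _ _)
    have h1 := abs_le.1 (hB (x + z)); have h2 := abs_le.1 (hB (x - z)); have h3 := abs_le.1 (hB x)
    unfold secondDiff
    rw [abs_le]; constructor <;> linarith
  · rw [min_eq_right h]
    have key := norm_symm_diff_le hd hL x z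
    rw [Real.norm_eq_abs] at key
    have e : secondDiff θ x z = θ (x + z) + θ (x - z) - (θ x + θ x) := by unfold secondDiff; ring
    rw [e]
    refine key.trans ?_
    have : 2 * (L : ℝ) ≤ max (4 * B) (2 * L) := le_max_right _ _
    nlinarith [mul_le_mul_of_nonneg_right this (sq_nonneg ‖z‖)]

lemma integrable_levy {N : ℕ} (hN : 3 ≤ N) {α : ℝ} (hα1 : 0 < α) (hα2 : α < 2) :
    Integrable (fun z : 𝔼 N => min 1 (‖z‖ ^ 2) / ‖z‖ ^ ((N : ℝ) + α)) := by
  have hfr : Module.finrank ℝ (𝔼 N) = N := by simp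
  have hm : AEStronglyMeasurable (fun z : 𝔼 N => min 1 (‖z‖ ^ 2) / ‖z‖ ^ ((N : ℝ) + α)) volume :=
    Measurable.aestronglyMeasurable (by fun_prop)
  have h1 : IntegrableOn (fun z : 𝔼 N => min 1 (‖z‖ ^ 2) / ‖z‖ ^ ((N : ℝ) + α))
      (Metric.ball 0 1) := by
    refine integrableOn_ball_of_norm_le_rpow (C := 1) (α := N + α - 2) (by rw [hfr]; omega)
      (by rw [hfr]; linarith) (ae_of_all _ fun z => ?_) hm
    rcases eq_or_ne z 0 with rfl | hz
    · simp; positivity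
    · have hz' : 0 < ‖z‖ := norm_pos_iff.2 hz
      rw [Real.norm_of_nonneg (by positivity), one_mul, show -((N : ℝ) + α - 2) = 2 - (N + α) by ring,
        Real.rpow_sub hz', Real.rpow_two]
      gcongr
      exact min_le_right _ _
  have h2 : IntegrableOn (fun z : 𝔼 N => min 1 (‖z‖ ^ 2) / ‖z‖ ^ ((N : ℝ) + α))
      (Metric.ball 0 1)ᶜ := by
    have h3 := (integrable_one_add_norm (E := 𝔼 N) (μ := volume) (r := N + α)
      (by rw [hfr]; linarith)).const_mul (2 ^ ((N : ℝ) + α))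
    refine Integrable.mono' h3.integrableOn hm.restrict ?_
    refine (ae_restrict_iff' measurableSet_ball.compl).2 (ae_of_all _ fun z hz => ?_)
    have hz' : 1 ≤ ‖z‖ := by simpa using hz
    rw [Real.norm_of_nonneg (by positivity), min_eq_left (by nlinarith), Real.rpow_neg (by positivity),
      ← div_eq_mul_inv, div_le_div_iff₀ (by positivity) (by positivity), one_mul,
      ← Real.mul_rpow (by norm_num) (by positivity)]
    gcongr
    linarith
  have := h1.union h2
  rwa [Set.union_compl_self, integrableOn_univ] at this

lemma abs_fracKernel_le {N : ℕ} {α : ℝ} {θ : 𝔼 N → ℝ} {C : ℝ}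
    (hC : ∀ x z, |secondDiff θ x z| ≤ C * min 1 (‖z‖ ^ 2)) (x z : 𝔼 N) :
    |fracKernel α θ x z| ≤ C * (min 1 (‖z‖ ^ 2) / ‖z‖ ^ ((N : ℝ) + α)) := by
  unfold fracKernel
  rw [abs_div, abs_of_nonneg (by positivity : 0 ≤ ‖z‖ ^ ((N : ℝ) + α)), ← mul_div_assoc]
  gcongr
  exact hC x z

lemma measurable_fracKernel {N : ℕ} {α : ℝ} {θ : 𝔼 N → ℝ} (hθ : Continuous θ) :
    Measurable (fun p : 𝔼 N × 𝔼 N => fracKernel α θ p.1 p.2) := by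
  unfold fracKernel secondDiff
  have : Continuous fun p : 𝔼 N × 𝔼 N => θ (p.1 + p.2) + θ (p.1 - p.2) - 2 * θ p.1 := by fun_prop
  have h2 : Measurable fun p : 𝔼 N × 𝔼 N => ‖p.2‖ ^ ((N : ℝ) + α) := by fun_prop
  exact this.measurable.div h2

lemma integrable_fracKernel_right {N : ℕ} (hN : 3 ≤ N) {α : ℝ} (hα1 : 0 < α) (hα2 : α < 2)
    {θ : 𝔼 N → ℝ} (hθ : ContDiff ℝ (⊤ : ℕ∞) θ) (hc : HasCompactSupport θ) (x : 𝔼 N) :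
    Integrable (fracKernel α θ x) := by
  obtain ⟨C, hC0, hC⟩ := secondDiff_le hθ hc
  refine ((integrable_levy hN hα1 hα2).const_mul C).mono' ?_ (ae_of_all _ fun z => ?_)
  · exact ((measurable_fracKernel hθ.continuous).comp measurable_prodMk_left).aestronglyMeasurable
  · exact abs_fracKernel_le hC x z

lemma integrable_fracKernel {N : ℕ} (hN : 3 ≤ N) {α : ℝ} (hα1 : 0 < α) (hα2 : α < 2)
    {θ : 𝔼 N → ℝ} (hθ : ContDiff ℝ (⊤ : ℕ∞) θ) (hc : HasCompactSupport θ) :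
    Integrable (fun p : 𝔼 N × 𝔼 N => fracKernel α θ p.1 p.2) (volume.prod volume) := by
  obtain ⟨C, hC0, hC⟩ := secondDiff_le hθ hc
  obtain ⟨R, hR0, hR⟩ := hc.isBounded.exists_pos_norm_le
  have hθR : ∀ y, R < ‖y‖ → θ y = 0 := fun y hy => by
    by_contra h
    exact absurd (hR y (subset_tsupport _ h)) (not_le.2 hy)
  have hθi : Integrable θ := hθ.continuous.integrable_of_hasCompactSupport hc
  have hi : ∀ z, Integrable (fun x => secondDiff θ x z) := fun z => by
    unfold secondDiff
    exact ((hθi.comp_add_right z).add (hθi.comp_sub_right z)).sub (hθi.const_mul 2)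
  set V := volume.real (Metric.closedBall (0 : 𝔼 N) (R + 1))
  set T := ∫ x, |θ x|
  have hT : 0 ≤ T := integral_nonneg fun _ => abs_nonneg _
  have hb : ∀ z, ∫ x, |secondDiff θ x z| ≤ (C * V + 4 * T) * min 1 (‖z‖ ^ 2) := by
    intro z
    rcases le_total (‖z‖) 1 with h | h
    · have h' : ‖z‖ ^ 2 ≤ 1 := by nlinarith [norm_nonneg z]
      rw [min_eq_right h']
      have : ∫ x, |secondDiff θ x z| ≤
          ∫ x, (Metric.closedBall (0 : 𝔼 N) (R + 1)).indicator (fun _ => C * ‖z‖ ^ 2) x := by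
        refine integral_mono (hi z).abs ((integrable_indicator_iff measurableSet_closedBall).2
          (integrableOn_const (by exact measure_closedBall_lt_top.ne))) fun x => ?_
        by_cases hx : x ∈ Metric.closedBall (0 : 𝔼 N) (R + 1)
        · simp only [Set.indicator_of_mem hx]
          have := hC x z
          rwa [min_eq_right h'] at this
        · have hx' : R + 1 < ‖x‖ := by simpa using hx
          have h1 : θ (x + z) = 0 := hθR _ (by
            have := norm_sub_le (x + z) z; simp at this; linarith)
          have h2 : θ (x - z) = 0 := hθR _ (by
            have := norm_add_le (x - z) z; simp at this; linarith)
          have h3 : θ x = 0 := hθR _ (by linarith)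
          simp [Set.indicator_of_notMem hx, secondDiff, h1, h2, h3]
      refine this.trans ?_
      rw [integral_indicator measurableSet_closedBall, setIntegral_const, smul_eq_mul]
      change V * _ ≤ _
      nlinarith [sq_nonneg ‖z‖, mul_nonneg hT (sq_nonneg ‖z‖)]
    · have h' : 1 ≤ ‖z‖ ^ 2 := by nlinarith [norm_nonneg z]
      rw [min_eq_left h', mul_one]
      have : ∫ x, |secondDiff θ x z| ≤ ∫ x, (|θ (x + z)| + |θ (x - z)| + 2 * |θ x|) := by
        refine integral_mono (hi z).abs ?_ fun x => ?_
        · exact ((hθi.abs.comp_add_right z).add (hθi.abs.comp_sub_right z)).add (hθi.abs.const_mul 2)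
        · unfold secondDiff
          simp only
          have h1 := abs_sub (θ (x + z) + θ (x - z)) (2 * θ x)
          have h2 := abs_add_le (θ (x + z)) (θ (x - z))
          rw [abs_mul, abs_two] at h1
          linarith
      refine this.trans ?_
      rw [integral_add, integral_add, integral_add_right_eq_self (fun x => |θ x|),
        integral_sub_right_eq_self (fun x => |θ x|), integral_const_mul]
      · change T + T + 2 * T ≤ _
        have : 0 ≤ C * V := mul_nonneg hC0 measureReal_nonneg
        linarith
      · exact hθi.abs.comp_add_right z
      · exact hθi.abs.comp_sub_right z
      · exact (hθi.abs.comp_add_right z).add (hθi.abs.comp_sub_right z)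
      · exact hθi.abs.const_mul 2
  have hm := (measurable_fracKernel (α := α) hθ.continuous)
  rw [integrable_prod_iff' hm.aestronglyMeasurable]
  constructor
  · refine ae_of_all _ fun z => ?_
    exact (hi z).div_const (‖z‖ ^ ((N : ℝ) + α))
  · refine ((integrable_levy hN hα1 hα2).const_mul (C * V + 4 * T)).mono'
      (hm.norm.stronglyMeasurable.integral_prod_left (μ := volume)).aestronglyMeasurable
      (ae_of_all _ fun z => ?_)
    rw [Real.norm_of_nonneg (integral_nonneg fun _ => norm_nonneg _)]
    have : ∀ x, ‖fracKernel α θ x z‖ = |secondDiff θ x z| / ‖z‖ ^ ((N : ℝ) + α) := fun x => by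
      unfold fracKernel
      rw [Real.norm_eq_abs, abs_div, abs_of_nonneg (by positivity : 0 ≤ ‖z‖ ^ ((N : ℝ) + α))]
    simp only [this]
    rw [integral_div, ← mul_div_assoc]
    gcongr
    exact hb z

section FracLap
variable {N : ℕ} {α : ℝ} {θ : 𝔼 N → ℝ}

lemma integral_abs_fracKernel_bound (hN : 3 ≤ N) (hα1 : 0 < α) (hα2 : α < 2)
    (hθ : ContDiff ℝ (⊤ : ℕ∞) θ) (hc : HasCompactSupport θ) :
    ∃ C, 0 ≤ C ∧ ∀ x, ∫ z, |fracKernel α θ x z| ≤ C := by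
  obtain ⟨C, hC0, hC⟩ := secondDiff_le hθ hc
  refine ⟨∫ z : 𝔼 N, C * (min 1 (‖z‖ ^ 2) / ‖z‖ ^ ((N : ℝ) + α)),
    integral_nonneg fun z => by positivity, fun x => ?_⟩
  exact integral_mono (integrable_fracKernel_right hN hα1 hα2 hθ hc x).abs
    ((integrable_levy hN hα1 hα2).const_mul C) fun z => abs_fracKernel_le hC x z

lemma integrable_mul_fracKernel (hN : 3 ≤ N) (hα1 : 0 < α) (hα2 : α < 2)
    (hθ : ContDiff ℝ (⊤ : ℕ∞) θ) (hc : HasCompactSupport θ) {g : 𝔼 N → ℝ} (hg : Measurable g)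
    (hgi : IntegrableOn g (Metric.ball 0 1)) {G : ℝ} (hG : ∀ x, 1 ≤ ‖x‖ → |g x| ≤ G) :
    Integrable (fun p : 𝔼 N × 𝔼 N => g p.1 * fracKernel α θ p.1 p.2) (volume.prod volume) := by
  have hm := measurable_fracKernel (α := α) hθ.continuous
  have hF := integrable_fracKernel hN hα1 hα2 hθ hc
  have hA : Integrable (fun x => ∫ z, |fracKernel α θ x z|) := hF.abs.integral_prod_left
  obtain ⟨C, hC0, hC⟩ := integral_abs_fracKernel_bound hN hα1 hα2 hθ hc
  have hgm : Measurable (fun p : 𝔼 N × 𝔼 N => g p.1 * fracKernel α θ p.1 p.2) :=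
    (hg.comp measurable_fst).mul hm
  rw [integrable_prod_iff hgm.aestronglyMeasurable]
  refine ⟨ae_of_all _ fun x => (integrable_fracKernel_right hN hα1 hα2 hθ hc x).const_mul (g x), ?_⟩
  have e : (fun x => ∫ z, ‖g x * fracKernel α θ x z‖) =
      fun x => |g x| * ∫ z, |fracKernel α θ x z| := by
    ext x
    simp only [norm_mul, Real.norm_eq_abs]
    rw [integral_const_mul]
  simp only [e]
  have hAn : ∀ x, 0 ≤ ∫ z, |fracKernel α θ x z| := fun x => integral_nonneg fun _ => abs_nonneg _
  have hms : AEStronglyMeasurable (fun x => |g x| * ∫ z, |fracKernel α θ x z|) volume :=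
    hg.abs.aestronglyMeasurable.mul hA.1
  have h1 : IntegrableOn (fun x => |g x| * ∫ z, |fracKernel α θ x z|) (Metric.ball 0 1) := by
    refine Integrable.mono' (Integrable.mul_const hgi.abs C) hms.restrict (ae_of_all _ fun x => ?_)
    rw [Real.norm_of_nonneg (mul_nonneg (abs_nonneg _) (hAn x))]
    exact mul_le_mul_of_nonneg_left (hC x) (abs_nonneg _)
  have h2 : IntegrableOn (fun x => |g x| * ∫ z, |fracKernel α θ x z|) (Metric.ball 0 1)ᶜ := by
    refine Integrable.mono' (hA.const_mul G).integrableOn hms.restrict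
      ((ae_restrict_iff' measurableSet_ball.compl).2 (ae_of_all _ fun x hx => ?_))
    rw [Real.norm_of_nonneg (mul_nonneg (abs_nonneg _) (hAn x))]
    exact mul_le_mul_of_nonneg_right (hG x (by simpa using hx)) (hAn x)
  have := h1.union h2
  rwa [Set.union_compl_self, integrableOn_univ] at this

lemma integral_mul_fracLap {g : 𝔼 N → ℝ} (h : Integrable
      (fun p : 𝔼 N × 𝔼 N => g p.1 * fracKernel α θ p.1 p.2) (volume.prod volume)) :
    ∫ x, g x * fracLap N α θ x = fracLapCoeff N α / 2 *
      ∫ z : 𝔼 N, (∫ x, g x * secondDiff θ x z) / ‖z‖ ^ ((N : ℝ) + α) := by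
  have e : (fun x => g x * fracLap N α θ x) =
      fun x => fracLapCoeff N α / 2 * ∫ z, g x * fracKernel α θ x z := by
    ext x
    rw [fracLap_eq, integral_const_mul]; ring
  rw [e, integral_const_mul, integral_integral_swap h]
  congr 2
  ext z
  rw [← integral_div]
  congr 1
  ext x
  unfold fracKernel
  ring

lemma integrable_mul_fracLap {g : 𝔼 N → ℝ} (h : Integrable
      (fun p : 𝔼 N × 𝔼 N => g p.1 * fracKernel α θ p.1 p.2) (volume.prod volume)) :
    Integrable (fun x => g x * fracLap N α θ x) := by
  refine (h.integral_prod_left.const_mul (fracLapCoeff N α / 2)).congr (ae_of_all _ fun x => ?_)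
  simp only
  rw [fracLap_eq, integral_const_mul]; ring

lemma integrable_fracLap (hN : 3 ≤ N) (hα1 : 0 < α) (hα2 : α < 2)
    (hθ : ContDiff ℝ (⊤ : ℕ∞) θ) (hc : HasCompactSupport θ) : Integrable (fracLap N α θ) :=
  (integrable_fracKernel hN hα1 hα2 hθ hc).integral_prod_left.const_mul _

lemma abs_fracLap_le (hα1 : 0 < α) (hα2 : α < 2) (x : 𝔼 N) :
    |fracLap N α θ x| ≤ fracLapCoeff N α / 2 * ∫ z, |fracKernel α θ x z| := by
  have := fracLapCoeff_pos (N := N) hα1 hα2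
  rw [fracLap_eq, abs_mul, abs_of_pos (by positivity)]
  gcongr
  exact abs_integral_le_integral_abs

lemma fracLap_bounded (hN : 3 ≤ N) (hα1 : 0 < α) (hα2 : α < 2)
    (hθ : ContDiff ℝ (⊤ : ℕ∞) θ) (hc : HasCompactSupport θ) :
    ∃ C, 0 ≤ C ∧ ∀ x, |fracLap N α θ x| ≤ C := by
  obtain ⟨C, hC0, hC⟩ := integral_abs_fracKernel_bound hN hα1 hα2 hθ hc
  have := fracLapCoeff_pos (N := N) hα1 hα2
  refine ⟨fracLapCoeff N α / 2 * C, by positivity, fun x => (abs_fracLap_le hα1 hα2 x).trans ?_⟩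
  gcongr
  exact hC x

lemma continuous_fracLap (hN : 3 ≤ N) (hα1 : 0 < α) (hα2 : α < 2)
    (hθ : ContDiff ℝ (⊤ : ℕ∞) θ) (hc : HasCompactSupport θ) : Continuous (fracLap N α θ) := by
  obtain ⟨C, hC0, hC⟩ := secondDiff_le hθ hc
  refine continuous_const.mul (continuous_of_dominated
    (fun x => (integrable_fracKernel_right hN hα1 hα2 hθ hc x).1)
    (fun x => ae_of_all _ fun z => abs_fracKernel_le hC x z)
    ((integrable_levy hN hα1 hα2).const_mul C) (ae_of_all _ fun z => ?_))
  have := hθ.continuous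
  fun_prop

lemma integral_mul_secondDiff_comm {ψ : 𝔼 N → ℝ} (hθ : Continuous θ) (hc : HasCompactSupport θ)
    (hψ : Continuous ψ) (hcψ : HasCompactSupport ψ) (z : 𝔼 N) :
    ∫ x, ψ x * secondDiff θ x z = ∫ x, θ x * secondDiff ψ x z := by
  have key : ∀ (a b : 𝔼 N → ℝ), Continuous a → HasCompactSupport a → Continuous b →
      ∫ x, a x * secondDiff b x z =
        (∫ x, a x * b (x + z)) + (∫ x, a x * b (x - z)) - 2 * ∫ x, a x * b x := by
    intro a b ha hca hb
    have h1 : Integrable fun x => a x * b (x + z) :=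
      (ha.mul (by fun_prop)).integrable_of_hasCompactSupport hca.mul_right
    have h2 : Integrable fun x => a x * b (x - z) :=
      (ha.mul (by fun_prop)).integrable_of_hasCompactSupport hca.mul_right
    have h3 : Integrable fun x => a x * b x :=
      (ha.mul (by fun_prop)).integrable_of_hasCompactSupport hca.mul_right
    have h4 : Integrable fun x => a x * b (x + z) + a x * b (x - z) := h1.add h2
    rw [← integral_const_mul, ← integral_add h1 h2, ← integral_sub h4 (h3.const_mul 2)]
    congr 1; ext x; simp only [secondDiff]; ring
  rw [key ψ θ hψ hcψ hθ, key θ ψ hθ hc hψ,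
    ← integral_add_right_eq_self (fun x => ψ x * θ (x - z)) z,
    ← integral_sub_right_eq_self (fun x => ψ x * θ (x + z)) z]
  simp only [add_sub_cancel_right, sub_add_cancel, mul_comm (ψ _)]
  ring

lemma integral_fracLap (hN : 3 ≤ N) (hα1 : 0 < α) (hα2 : α < 2)
    (hθ : ContDiff ℝ (⊤ : ℕ∞) θ) (hc : HasCompactSupport θ) : ∫ x, fracLap N α θ x = 0 := by
  have h := integral_mul_fracLap (g := fun _ => 1) (integrable_mul_fracKernel hN hα1 hα2 hθ hc
    measurable_const (integrableOn_const (by exact measure_ball_lt_top.ne)) (G := 1) (by simp))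
  simp only [one_mul] at h
  rw [h]
  have hθi : Integrable θ := hθ.continuous.integrable_of_hasCompactSupport hc
  have : ∀ z, ∫ x, secondDiff θ x z = 0 := fun z => by
    unfold secondDiff
    rw [integral_sub, integral_add, integral_add_right_eq_self θ, integral_sub_right_eq_self θ,
      integral_const_mul]
    · ring
    · exact hθi.comp_add_right z
    · exact hθi.comp_sub_right z
    · exact (hθi.comp_add_right z).add (hθi.comp_sub_right z)
    · exact hθi.const_mul 2
  simp [this]

lemma integral_mul_fracLap_comm (hN : 3 ≤ N) (hα1 : 0 < α) (hα2 : α < 2)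
    (hθ : ContDiff ℝ (⊤ : ℕ∞) θ) (hc : HasCompactSupport θ) {ψ : 𝔼 N → ℝ}
    (hψ : ContDiff ℝ (⊤ : ℕ∞) ψ) (hcψ : HasCompactSupport ψ) :
    ∫ x, ψ x * fracLap N α θ x = ∫ x, θ x * fracLap N α ψ x := by
  obtain ⟨B1, hB1⟩ := hc.exists_bound_of_continuous hθ.continuous
  obtain ⟨B2, hB2⟩ := hcψ.exists_bound_of_continuous hψ.continuous
  have hθi : Integrable θ := hθ.continuous.integrable_of_hasCompactSupport hc
  have hψi : Integrable ψ := hψ.continuous.integrable_of_hasCompactSupport hcψ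
  rw [integral_mul_fracLap (integrable_mul_fracKernel hN hα1 hα2 hθ hc hψ.continuous.measurable
    hψi.integrableOn fun x _ => hB2 x), integral_mul_fracLap (integrable_mul_fracKernel hN hα1 hα2
    hψ hcψ hθ.continuous.measurable hθi.integrableOn fun x _ => hB1 x)]
  congr 2; ext z
  rw [integral_mul_secondDiff_comm hθ.continuous hc hψ.continuous hcψ]

lemma fracLap_scale (θ : 𝔼 N → ℝ) {r : ℝ} (hr : 0 < r) (x₀ x : 𝔼 N) :
    fracLap N α (fun y => θ (r⁻¹ • (y - x₀))) x = r ^ (-α) * fracLap N α θ (r⁻¹ • (x - x₀)) := by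
  rw [fracLap_eq, fracLap_eq]
  have h := Measure.integral_comp_smul (volume : Measure (𝔼 N))
    (fun z => fracKernel α θ (r⁻¹ • (x - x₀)) z) r⁻¹
  have e : ∀ z, fracKernel α (fun y => θ (r⁻¹ • (y - x₀))) x z =
      r ^ (-((N : ℝ) + α)) * fracKernel α θ (r⁻¹ • (x - x₀)) (r⁻¹ • z) := by
    intro z
    unfold fracKernel secondDiff
    have e1 : r⁻¹ • (x + z - x₀) = r⁻¹ • (x - x₀) + r⁻¹ • z := by rw [← smul_add]; congr 1; abel
    have e2 : r⁻¹ • (x - z - x₀) = r⁻¹ • (x - x₀) - r⁻¹ • z := by rw [← smul_sub]; congr 1; abel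
    simp only [e1, e2]
    rw [norm_smul, Real.norm_of_nonneg (by positivity), Real.mul_rpow (by positivity)
      (by positivity), Real.inv_rpow hr.le, Real.rpow_neg hr.le]
    have : 0 < r ^ ((N : ℝ) + α) := by positivity
    field_simp
  simp only [e]
  rw [integral_const_mul, h]
  simp only [finrank_euclideanSpace, Fintype.card_fin, smul_eq_mul, inv_pow, inv_inv]
  rw [abs_of_pos (by positivity), neg_add, Real.rpow_add hr, Real.rpow_neg hr.le, Real.rpow_natCast]
  field_simp

lemma fracLap_isometry (θ : 𝔼 N → ℝ) (e : 𝔼 N ≃ₗᵢ[ℝ] 𝔼 N) (hθ : ∀ x, θ (e x) = θ x) (x : 𝔼 N) :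
    fracLap N α θ (e x) = fracLap N α θ x := by
  rw [fracLap_eq, fracLap_eq]
  rw [← e.measurePreserving.integral_comp e.toHomeomorph.measurableEmbedding]
  congr 2; ext z
  unfold fracKernel secondDiff
  rw [← map_add, ← map_sub, hθ, hθ, hθ, e.norm_map]

lemma fracLap_radial (θ : 𝔼 N → ℝ) (hθ : ∀ x y, ‖x‖ = ‖y‖ → θ x = θ y) (x y : 𝔼 N)
    (h : ‖x‖ = ‖y‖) : fracLap N α θ x = fracLap N α θ y := by
  have := fracLap_isometry (α := α) θ ((ℝ ∙ (x - y))ᗮ.reflection)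
    (fun z => hθ _ _ (LinearIsometryEquiv.norm_map _ z)) x
  rwa [Submodule.reflection_sub h, eq_comm] at this

lemma fracLap_decay (hN : 3 ≤ N) (hα1 : 0 < α) (hα2 : α < 2)
    (hθ : ContDiff ℝ (⊤ : ℕ∞) θ) (hc : HasCompactSupport θ) :
    ∃ C, 0 ≤ C ∧ ∀ x, x ≠ 0 → |fracLap N α θ x| ≤ C * ‖x‖ ^ (-((N : ℝ) + α)) := by
  obtain ⟨R, hR0, hR⟩ := hc.isBounded.exists_pos_norm_le
  have hθR : ∀ y, R < ‖y‖ → θ y = 0 := fun y hy => by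
    by_contra h
    exact absurd (hR y (subset_tsupport _ h)) (not_le.2 hy)
  have hθi : Integrable θ := hθ.continuous.integrable_of_hasCompactSupport hc
  obtain ⟨B, hB0, hB⟩ := fracLap_bounded hN hα1 hα2 hθ hc
  have hcp := fracLapCoeff_pos (N := N) hα1 hα2
  set T := ∫ x, |θ x|
  have hT : 0 ≤ T := integral_nonneg fun _ => abs_nonneg _
  set p : ℝ := (N : ℝ) + α
  have hp : 0 < p := by positivity
  refine ⟨B * (2 * R) ^ p + fracLapCoeff N α * 2 ^ p * T, by positivity, fun x hx => ?_⟩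
  have hx0 : 0 < ‖x‖ := norm_pos_iff.2 hx
  have hpos : 0 < ‖x‖ ^ p := by positivity
  rw [Real.rpow_neg hx0.le, ← div_eq_mul_inv, le_div_iff₀ hpos]
  rcases le_total ‖x‖ (2 * R) with h | h
  · have h1 : |fracLap N α θ x| * ‖x‖ ^ p ≤ B * (2 * R) ^ p := by
      gcongr
      exact hB x
    have h2 : 0 ≤ fracLapCoeff N α * 2 ^ p * T := by positivity
    linarith
  · have hk : ∀ z, |fracKernel α θ x z| ≤ (2 / ‖x‖) ^ p * (|θ (x + z)| + |θ (x - z)|) := by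
      intro z
      have h0 : θ x = 0 := hθR x (by linarith)
      unfold fracKernel secondDiff
      rw [h0, mul_zero, sub_zero, abs_div, abs_of_nonneg (by positivity : 0 ≤ ‖z‖ ^ p)]
      rcases lt_or_ge ‖z‖ (‖x‖ / 2) with hz | hz
      · rw [hθR (x + z) (by have := norm_sub_le (x + z) z; simp at this; linarith),
          hθR (x - z) (by have := norm_add_le (x - z) z; simp at this; linarith)]
        simp
      · have hz0 : 0 < ‖z‖ := by linarith
        rw [div_le_iff₀ (by positivity), mul_right_comm, ← Real.mul_rpow (by positivity) (by positivity)]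
        have h3 : 1 ≤ (2 / ‖x‖ * ‖z‖) ^ p := by
          apply Real.one_le_rpow _ hp.le
          rw [div_mul_eq_mul_div, le_div_iff₀ hx0]; linarith
        have h4 := abs_add_le (θ (x + z)) (θ (x - z))
        nlinarith [abs_nonneg (θ (x + z)), abs_nonneg (θ (x - z))]
    have i1 : Integrable fun z => |θ (x + z)| := hθi.abs.comp_add_left x
    have i2 : Integrable fun z => |θ (x - z)| := hθi.abs.comp_sub_left x
    have h5 : ∫ z, |fracKernel α θ x z| ≤ (2 / ‖x‖) ^ p * (T + T) := by
      refine (integral_mono (integrable_fracKernel_right hN hα1 hα2 hθ hc x).abs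
        ((i1.add i2).const_mul _) hk).trans_eq ?_
      rw [integral_const_mul]
      simp only [Pi.add_apply]
      rw [integral_add i1 i2, integral_add_left_eq_self (fun z => |θ z|),
        integral_sub_left_eq_self (fun z => |θ z|)]
    have h6 := (abs_fracLap_le (θ := θ) hα1 hα2 x).trans (mul_le_mul_of_nonneg_left h5 (by positivity))
    have h7 : |fracLap N α θ x| * ‖x‖ ^ p ≤ fracLapCoeff N α * 2 ^ p * T := by
      refine (mul_le_mul_of_nonneg_right h6 hpos.le).trans_eq ?_
      rw [Real.div_rpow (by norm_num) hx0.le]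
      field_simp
      ring
    have h8 : 0 ≤ B * (2 * R) ^ p := by positivity
    linarith

end FracLap

/-- A smooth, compactly supported, radially decreasing bump function. -/
def radialBump (N : ℕ) (x : 𝔼 N) : ℝ := expNegInvGlue (1 - ‖x‖ ^ 2)

lemma radialBump_contDiff (N : ℕ) : ContDiff ℝ (⊤ : ℕ∞) (radialBump N) :=
  expNegInvGlue.contDiff.comp (contDiff_const.sub (contDiff_norm_sq ℝ))

lemma radialBump_eq_zero {N : ℕ} {x : 𝔼 N} (hx : 1 ≤ ‖x‖) : radialBump N x = 0 :=
  expNegInvGlue.zero_of_nonpos (by nlinarith)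

lemma radialBump_hasCompactSupport (N : ℕ) : HasCompactSupport (radialBump N) := by
  refine HasCompactSupport.intro (isCompact_closedBall 0 1) fun x hx => radialBump_eq_zero ?_
  have : 1 < ‖x‖ := by simpa using hx
  exact this.le

lemma radialBump_nonneg {N : ℕ} (x : 𝔼 N) : 0 ≤ radialBump N x := expNegInvGlue.nonneg _

lemma radialBump_anti {N : ℕ} {x y : 𝔼 N} (h : ‖x‖ ≤ ‖y‖) : radialBump N y ≤ radialBump N x := by
  apply expNegInvGlue.monotone
  have := norm_nonneg x
  nlinarith

lemma radialBump_strictAnti {N : ℕ} {x y : 𝔼 N} (h1 : ‖x‖ < 1) (h : ‖x‖ < ‖y‖) :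
    radialBump N y < radialBump N x := by
  have hx := norm_nonneg x
  have h2 : 0 < 1 - ‖x‖ ^ 2 := by nlinarith
  unfold radialBump
  rcases le_or_gt (1 - ‖y‖ ^ 2) 0 with h3 | h3
  · rw [expNegInvGlue.zero_of_nonpos h3]
    exact expNegInvGlue.pos_of_pos h2
  · rw [expNegInvGlue, expNegInvGlue, if_neg (not_le.2 h3), if_neg (not_le.2 h2), Real.exp_lt_exp,
      neg_lt_neg_iff]
    apply inv_strictAnti₀ h3
    nlinarith

lemma radialBump_radial {N : ℕ} (x y : 𝔼 N) (h : ‖x‖ = ‖y‖) : radialBump N x = radialBump N y := by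
  unfold radialBump; rw [h]

/-- The fractional Laplacian of the smoothed kernel obtained by superposing the dilates
of `radialBump` of scale at least one. -/
def smoothedDelta (N : ℕ) (α : ℝ) (x : 𝔼 N) : ℝ :=
  ∫ r in Set.Ioi (1 : ℝ), r ^ (-(N : ℝ) - 1) * fracLap N α (radialBump N) (r⁻¹ • x)

section
variable {N : ℕ} {α : ℝ}

lemma continuous_fracLap_bump (hN : 3 ≤ N) (hα1 : 0 < α) (hα2 : α < 2) :
    Continuous (fracLap N α (radialBump N)) :=
  continuous_fracLap hN hα1 hα2 (radialBump_contDiff N) (radialBump_hasCompactSupport N)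

lemma integrable_fracLap_bump (hN : 3 ≤ N) (hα1 : 0 < α) (hα2 : α < 2) :
    Integrable (fracLap N α (radialBump N)) :=
  integrable_fracLap hN hα1 hα2 (radialBump_contDiff N) (radialBump_hasCompactSupport N)

lemma measurable_dilate (hN : 3 ≤ N) (hα1 : 0 < α) (hα2 : α < 2) :
    Measurable (fun p : 𝔼 N × ℝ =>
      p.2 ^ (-(N : ℝ) - 1) * fracLap N α (radialBump N) (p.2⁻¹ • p.1)) := by
  have h1 : Measurable fun p : 𝔼 N × ℝ => p.2⁻¹ • p.1 := by fun_prop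
  have h2 := (continuous_fracLap_bump hN hα1 hα2).measurable.comp h1
  have h3 : Measurable fun p : 𝔼 N × ℝ => p.2 ^ (-(N : ℝ) - 1) := by fun_prop
  exact h3.mul h2

lemma integrableOn_dilate (hN : 3 ≤ N) (hα1 : 0 < α) (hα2 : α < 2) {ε : ℝ} (hε : 0 < ε) (x : 𝔼 N) :
    IntegrableOn (fun r : ℝ => r ^ (-(N : ℝ) - 1) * fracLap N α (radialBump N) (r⁻¹ • x))
      (Set.Ioi ε) := by
  obtain ⟨B, hB0, hB⟩ := fracLap_bounded hN hα1 hα2 (radialBump_contDiff N)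
    (radialBump_hasCompactSupport N)
  have hN' : (3 : ℝ) ≤ N := by exact_mod_cast hN
  refine Integrable.mono' ((integrableOn_Ioi_rpow_of_lt (a := -(N : ℝ) - 1) (by linarith) hε).mul_const B)
    ((measurable_dilate hN hα1 hα2).comp measurable_prodMk_left).aestronglyMeasurable
    ((ae_restrict_iff' measurableSet_Ioi).2 (ae_of_all _ fun r hr => ?_))
  have hr' : 0 < r := hε.trans hr
  rw [norm_mul, Real.norm_of_nonneg (by positivity)]
  gcongr
  exact hB _

lemma setIntegral_dilate_Ioi {ε : ℝ} (hε : 0 < ε) (x : 𝔼 N) :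
    ∫ r in Set.Ioi ε, r ^ (-(N : ℝ) - 1) * fracLap N α (radialBump N) (r⁻¹ • x) =
      ε ^ (-(N : ℝ)) * smoothedDelta N α (ε⁻¹ • x) := by
  have h := integral_comp_mul_left_Ioi'
    (fun r : ℝ => r ^ (-(N : ℝ) - 1) * fracLap N α (radialBump N) (r⁻¹ • x)) 1 hε
  rw [mul_one] at h
  rw [← h, smoothedDelta, smul_eq_mul, ← integral_const_mul, ← integral_const_mul]
  refine setIntegral_congr_fun measurableSet_Ioi fun r hr => ?_
  have hr' : 0 < r := zero_lt_one.trans hr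
  rw [Real.mul_rpow hε.le hr'.le, Real.rpow_sub_one hε.ne', mul_inv, smul_smul, mul_comm r⁻¹]
  field_simp

lemma setIntegral_dilate_Ioc (hN : 3 ≤ N) (hα1 : 0 < α) (hα2 : α < 2) {ε R : ℝ} (hε : 0 < ε)
    (hR : ε ≤ R) (x : 𝔼 N) :
    ∫ r in Set.Ioc ε R, r ^ (-(N : ℝ) - 1) * fracLap N α (radialBump N) (r⁻¹ • x) =
      ε ^ (-(N : ℝ)) * smoothedDelta N α (ε⁻¹ • x) - R ^ (-(N : ℝ)) * smoothedDelta N α (R⁻¹ • x) := by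
  rw [← setIntegral_dilate_Ioi hε, ← setIntegral_dilate_Ioi (hε.trans_le hR),
    ← Set.Ioc_union_Ioi_eq_Ioi hR, setIntegral_union (Set.Ioc_disjoint_Ioi le_rfl) measurableSet_Ioi]
  · ring
  · exact (integrableOn_dilate hN hα1 hα2 hε x).mono_set Set.Ioc_subset_Ioi_self
  · exact integrableOn_dilate hN hα1 hα2 (hε.trans_le hR) x

lemma integral_dilate_eq_zero (hN : 3 ≤ N) (hα1 : 0 < α) (hα2 : α < 2) {x : 𝔼 N} (hx : x ≠ 0) :
    ∫ r in Set.Ioi (0 : ℝ), r ^ (-(N : ℝ) - 1) * fracLap N α (radialBump N) (r⁻¹ • x) = 0 := by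
  have hx0 : 0 < ‖x‖ := norm_pos_iff.2 hx
  have hnt : Nontrivial (𝔼 N) := nontrivial_of_ne x 0 hx
  set h := fracLap N α (radialBump N)
  have hrad : ∀ y : 𝔼 N, h y = h ((‖y‖ / ‖x‖) • x) := fun y =>
    fracLap_radial _ radialBump_radial _ _ (by
      rw [norm_smul, norm_div, norm_norm, norm_norm, div_mul_cancel₀ _ hx0.ne'])
  have h0 : ∫ y, h y = 0 :=
    integral_fracLap hN hα1 hα2 (radialBump_contDiff N) (radialBump_hasCompactSupport N)
  have h1 : ∫ y : 𝔼 N, h ((‖y‖ / ‖x‖) • x) = 0 := by rw [← h0]; simp only [← hrad]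
  rw [integral_fun_norm_addHaar volume (fun t : ℝ => h ((t / ‖x‖) • x)),
    finrank_euclideanSpace, Fintype.card_fin, nsmul_eq_mul, smul_eq_mul] at h1
  have hV : 0 < volume.real (Metric.ball (0 : 𝔼 N) 1) :=
    ENNReal.toReal_pos (Metric.measure_ball_pos _ _ one_pos).ne' measure_ball_lt_top.ne
  have hN' : (3 : ℝ) ≤ N := by exact_mod_cast hN
  have h2 : ∫ t in Set.Ioi (0 : ℝ), t ^ (N - 1) • h ((t / ‖x‖) • x) = 0 := by
    have hNpos : (N : ℝ) ≠ 0 := by linarith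
    simpa [hNpos, hV.ne'] using h1
  have h3 := integral_comp_mul_left_Ioi
    (fun t : ℝ => t ^ (N - 1) • h ((t / ‖x‖) • x)) 0 hx0
  rw [mul_zero, h2, smul_zero] at h3
  have h4 := integral_comp_rpow_Ioi
    (fun t : ℝ => (‖x‖ * t) ^ (N - 1) • h ((‖x‖ * t / ‖x‖) • x)) (p := -1) (by norm_num)
  rw [h3] at h4
  have h5 : ∀ r ∈ Set.Ioi (0 : ℝ),
      (|(-1 : ℝ)| * r ^ ((-1 : ℝ) - 1)) • ((‖x‖ * r ^ (-1 : ℝ)) ^ (N - 1) •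
        h ((‖x‖ * r ^ (-1 : ℝ) / ‖x‖) • x)) =
      ‖x‖ ^ (N - 1) * (r ^ (-(N : ℝ) - 1) * h (r⁻¹ • x)) := by
    intro r hr
    have hr' : (0 : ℝ) < r := hr
    rw [Real.rpow_neg_one, mul_div_cancel_left₀ _ hx0.ne', smul_eq_mul, smul_eq_mul, mul_pow, abs_neg,
      abs_one, one_mul]
    have : r ^ (-(N : ℝ) - 1) = r ^ ((-1 : ℝ) - 1) * (r⁻¹) ^ (N - 1) := by
      rw [← Real.rpow_natCast, Real.inv_rpow hr'.le, ← Real.rpow_neg hr'.le, ← Real.rpow_add hr',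
        Nat.cast_sub (by omega)]
      congr 1; push_cast; ring
    rw [this]; ring
  rw [setIntegral_congr_fun measurableSet_Ioi h5, integral_const_mul] at h4
  exact (mul_eq_zero.1 h4).resolve_left (by positivity)

lemma smoothedDelta_bound (hN : 3 ≤ N) (hα1 : 0 < α) (hα2 : α < 2) :
    ∃ C, 0 ≤ C ∧ ∀ x, |smoothedDelta N α x| ≤ C * (1 + ‖x‖) ^ (-((N : ℝ) + α)) := by
  obtain ⟨B, hB0, hB⟩ := fracLap_bounded hN hα1 hα2 (radialBump_contDiff N)
    (radialBump_hasCompactSupport N)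
  obtain ⟨D, hD0, hD⟩ := fracLap_decay hN hα1 hα2 (radialBump_contDiff N)
    (radialBump_hasCompactSupport N)
  have hN' : (3 : ℝ) ≤ N := by exact_mod_cast hN
  set p : ℝ := (N : ℝ) + α
  have hp : 0 < p := by positivity
  have b1 : ∀ x, |smoothedDelta N α x| ≤ B := by
    intro x
    have i := integrableOn_Ioi_rpow_of_lt (a := -(N : ℝ) - 1) (by linarith) one_pos
    have : ‖smoothedDelta N α x‖ ≤ ∫ r in Set.Ioi (1 : ℝ), r ^ (-(N : ℝ) - 1) * B := by
      refine norm_integral_le_of_norm_le (i.mul_const B)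
        ((ae_restrict_iff' measurableSet_Ioi).2 (ae_of_all _ fun r hr => ?_))
      have hr' : 0 < r := zero_lt_one.trans hr
      rw [norm_mul, Real.norm_of_nonneg (by positivity)]
      gcongr
      exact hB _
    refine this.trans ?_
    rw [integral_mul_const, integral_Ioi_rpow_of_lt (by linarith) one_pos]
    simp only [Real.one_rpow]
    have : -1 / (-(N : ℝ) - 1 + 1) ≤ 1 := by
      rw [show -(N : ℝ) - 1 + 1 = -N by ring, neg_div_neg_eq, div_le_one (by linarith)]; linarith
    nlinarith
  have b2 : ∀ x, x ≠ 0 → |smoothedDelta N α x| ≤ D / α * ‖x‖ ^ (-p) := by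
    intro x hx
    have hx0 : 0 < ‖x‖ := norm_pos_iff.2 hx
    have hb : ∀ r ∈ Set.Ioc (0 : ℝ) 1,
        ‖r ^ (-(N : ℝ) - 1) * fracLap N α (radialBump N) (r⁻¹ • x)‖ ≤
          r ^ (α - 1) * (D * ‖x‖ ^ (-p)) := by
      intro r hr
      have hr' : 0 < r := hr.1
      rw [norm_mul, Real.norm_of_nonneg (by positivity)]
      have := hD (r⁻¹ • x) (by simp [hx, hr'.ne'])
      rw [norm_smul, Real.norm_of_nonneg (by positivity), Real.mul_rpow (by positivity) hx0.le,
        Real.inv_rpow hr'.le, Real.rpow_neg hr'.le, inv_inv] at this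
      refine (mul_le_mul_of_nonneg_left this (by positivity)).trans_eq ?_
      have e : r ^ (α - 1) = r ^ (-(N : ℝ) - 1) * r ^ p := by
        rw [← Real.rpow_add hr']; congr 1; simp only [p]; ring
      rw [e]; ring
    have i : IntegrableOn (fun r : ℝ => r ^ (α - 1)) (Set.Ioc 0 1) := by
      have := intervalIntegral.intervalIntegrable_rpow' (a := 0) (b := 1) (r := α - 1) (by linarith)
      rwa [intervalIntegrable_iff_integrableOn_Ioc_of_le zero_le_one] at this
    have i2 : IntegrableOn (fun r : ℝ => r ^ (-(N : ℝ) - 1) *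
        fracLap N α (radialBump N) (r⁻¹ • x)) (Set.Ioc 0 1) :=
      Integrable.mono' (i.mul_const (D * ‖x‖ ^ (-p)))
        ((measurable_dilate hN hα1 hα2).comp measurable_prodMk_left).aestronglyMeasurable
        ((ae_restrict_iff' measurableSet_Ioc).2 (ae_of_all _ hb))
    have h0 := integral_dilate_eq_zero hN hα1 hα2 hx
    rw [← Set.Ioc_union_Ioi_eq_Ioi (zero_le_one (α := ℝ)), setIntegral_union
      (Set.Ioc_disjoint_Ioi le_rfl) measurableSet_Ioi i2
      (integrableOn_dilate hN hα1 hα2 one_pos x)] at h0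
    have h1 : smoothedDelta N α x = -∫ r in Set.Ioc (0 : ℝ) 1, r ^ (-(N : ℝ) - 1) *
        fracLap N α (radialBump N) (r⁻¹ • x) := by
      unfold smoothedDelta; linarith
    rw [h1, abs_neg]
    have : ‖∫ r in Set.Ioc (0 : ℝ) 1, r ^ (-(N : ℝ) - 1) * fracLap N α (radialBump N) (r⁻¹ • x)‖ ≤
        ∫ r in Set.Ioc (0 : ℝ) 1, r ^ (α - 1) * (D * ‖x‖ ^ (-p)) :=
      norm_integral_le_of_norm_le (i.mul_const _)
        ((ae_restrict_iff' measurableSet_Ioc).2 (ae_of_all _ hb))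
    refine this.trans_eq ?_
    rw [integral_mul_const, ← intervalIntegral.integral_of_le zero_le_one,
      integral_rpow (Or.inl (by linarith))]
    rw [sub_add_cancel, Real.one_rpow, Real.zero_rpow hα1.ne']
    field_simp
    ring
  refine ⟨2 ^ p * (B + D / α), by positivity, fun x => ?_⟩
  have hpos : 0 < (1 + ‖x‖) ^ p := by positivity
  have hDα : 0 ≤ D / α := by positivity
  rw [Real.rpow_neg (by positivity), ← div_eq_mul_inv, le_div_iff₀ hpos]
  rcases le_total ‖x‖ 1 with h | h
  · have : |smoothedDelta N α x| * (1 + ‖x‖) ^ p ≤ B * 2 ^ p := by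
      gcongr
      · exact b1 x
      · linarith
    have : 0 ≤ 2 ^ p * (D / α) := by positivity
    linarith
  · have hx0 : 0 < ‖x‖ := by linarith
    have h1 : (1 + ‖x‖) ^ p ≤ 2 ^ p * ‖x‖ ^ p := by
      rw [← Real.mul_rpow (by norm_num) hx0.le]
      gcongr
      linarith
    have : |smoothedDelta N α x| * (1 + ‖x‖) ^ p ≤ (D / α * ‖x‖ ^ (-p)) * (2 ^ p * ‖x‖ ^ p) := by
      gcongr
      exact b2 x (norm_pos_iff.1 hx0)
    rw [Real.rpow_neg hx0.le] at this
    have e : D / α * (‖x‖ ^ p)⁻¹ * (2 ^ p * ‖x‖ ^ p) = 2 ^ p * (D / α) := by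
      field_simp
    rw [e] at this
    have : 0 ≤ 2 ^ p * B := by positivity
    linarith

lemma integrable_smoothedDelta (hN : 3 ≤ N) (hα1 : 0 < α) (hα2 : α < 2) :
    Integrable (smoothedDelta N α) := by
  obtain ⟨C, hC0, hC⟩ := smoothedDelta_bound hN hα1 hα2
  refine ((integrable_one_add_norm (E := 𝔼 N) (μ := volume) (r := N + α)
    (by simp; linarith)).const_mul C).mono' ?_ (ae_of_all _ hC)
  exact ((measurable_dilate hN hα1 hα2).stronglyMeasurable.integral_prod_right
    (ν := volume.restrict (Set.Ioi 1))).aestronglyMeasurable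

end

section
variable {N : ℕ} {α : ℝ}

lemma integral_comp_dilate (F : 𝔼 N → ℝ) {r : ℝ} (hr : 0 < r) (x₀ : 𝔼 N) :
    ∫ x, F (r⁻¹ • (x - x₀)) = r ^ (N : ℝ) * ∫ x, F x := by
  rw [integral_sub_right_eq_self (fun x => F (r⁻¹ • x)) x₀,
    Measure.integral_comp_inv_smul_of_nonneg _ _ hr.le, finrank_euclideanSpace, Fintype.card_fin,
    smul_eq_mul, Real.rpow_natCast]

lemma integrable_comp_dilate {F : 𝔼 N → ℝ} (hF : Integrable F) {r : ℝ} (hr : 0 < r) (x₀ : 𝔼 N) :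
    Integrable (fun x => F (r⁻¹ • (x - x₀))) :=
  (hF.comp_smul (inv_ne_zero hr.ne')).comp_sub_right x₀

lemma integrable_dilate_prod (hN : 3 ≤ N) (hα1 : 0 < α) (hα2 : α < 2) {ε R : ℝ} (hε : 0 < ε)
    (x₀ : 𝔼 N) {v : 𝔼 N → ℝ} (hv : Measurable v) {M : ℝ} (hM : ∀ x, |v x| ≤ M) :
    Integrable (fun p : ℝ × 𝔼 N => v p.2 * (p.1 ^ (-(N : ℝ) - 1) *
      fracLap N α (radialBump N) (p.1⁻¹ • (p.2 - x₀))))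
      ((volume.restrict (Set.Ioc ε R)).prod volume) := by
  have hi := integrable_fracLap_bump (N := N) hN hα1 hα2
  have hm : Measurable (fun p : ℝ × 𝔼 N => p.1 ^ (-(N : ℝ) - 1) *
      fracLap N α (radialBump N) (p.1⁻¹ • (p.2 - x₀))) := by
    have h0 : Measurable (fun p : ℝ × 𝔼 N => (p.2 - x₀, p.1)) := by fun_prop
    exact (measurable_dilate hN hα1 hα2).comp h0
  refine Integrable.bdd_mul (c := M) ?_ (hv.comp measurable_snd).aestronglyMeasurable
    (ae_of_all _ fun p => hM p.2)
  rw [integrable_prod_iff hm.aestronglyMeasurable]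
  constructor
  · refine (ae_restrict_iff' measurableSet_Ioc).2 (ae_of_all _ fun r hr => ?_)
    exact (integrable_comp_dilate hi (hε.trans hr.1) x₀).const_mul (r ^ (-(N : ℝ) - 1))
  · have i : IntegrableOn (fun r : ℝ => r⁻¹ * ∫ x, |fracLap N α (radialBump N) x|)
        (Set.Ioc ε R) := by
      refine (ContinuousOn.integrableOn_Icc ?_).mono_set Set.Ioc_subset_Icc_self
      refine ContinuousOn.mul (continuousOn_id.inv₀ fun x hx => (hε.trans_le hx.1).ne')
        continuousOn_const
    refine i.congr ((ae_restrict_iff' measurableSet_Ioc).2 (ae_of_all _ fun r hr => ?_))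
    have hr' : 0 < r := hε.trans hr.1
    simp only [norm_mul]
    rw [integral_const_mul, Real.norm_of_nonneg (by positivity)]
    simp only [Real.norm_eq_abs]
    rw [integral_comp_dilate (fun x => |fracLap N α (radialBump N) x|) hr' x₀, ← mul_assoc,
      ← Real.rpow_add hr', show -(N : ℝ) - 1 + N = -1 by ring, Real.rpow_neg_one]

/-- Superposition of dilates of `fracLap radialBump` tested against a bounded function. -/
lemma integral_dilate_test (hN : 3 ≤ N) (hα1 : 0 < α) (hα2 : α < 2) {ε R : ℝ} (hε : 0 < ε)
    (hR : ε ≤ R) (x₀ : 𝔼 N) {v : 𝔼 N → ℝ} (hv : Measurable v) {M : ℝ} (hM : ∀ x, |v x| ≤ M) :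
    ∫ r in Set.Ioc ε R, r ^ (-(N : ℝ) - 1) *
        ∫ x, v x * fracLap N α (radialBump N) (r⁻¹ • (x - x₀)) =
      (∫ y, v (x₀ + ε • y) * smoothedDelta N α y) - ∫ y, v (x₀ + R • y) * smoothedDelta N α y := by
  have hp := integrable_dilate_prod (R := R) hN hα1 hα2 hε x₀ hv hM
  have hP := integrable_smoothedDelta (N := N) hN hα1 hα2
  have key : ∀ s : ℝ, 0 < s → Integrable (fun x =>
      v x * (s ^ (-(N : ℝ)) * smoothedDelta N α (s⁻¹ • (x - x₀)))) ∧
      ∫ x, v x * (s ^ (-(N : ℝ)) * smoothedDelta N α (s⁻¹ • (x - x₀))) =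
        ∫ y, v (x₀ + s • y) * smoothedDelta N α y := by
    intro s hs
    refine ⟨((integrable_comp_dilate hP hs x₀).const_mul (s ^ (-(N : ℝ)))).bdd_mul (c := M)
      hv.aestronglyMeasurable (ae_of_all _ hM), ?_⟩
    have e := integral_comp_dilate (fun y => v (x₀ + s • y) * smoothedDelta N α y) hs x₀
    have e2 : ∀ x, x₀ + s • s⁻¹ • (x - x₀) = x := fun x => by
      rw [smul_inv_smul₀ hs.ne']; abel
    simp only [e2] at e
    have e3 : ∀ x, v x * (s ^ (-(N : ℝ)) * smoothedDelta N α (s⁻¹ • (x - x₀))) =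
        s ^ (-(N : ℝ)) * (v x * smoothedDelta N α (s⁻¹ • (x - x₀))) := fun x => by ring
    simp only [e3]
    rw [integral_const_mul, e, ← mul_assoc, ← Real.rpow_add hs, neg_add_cancel, Real.rpow_zero,
      one_mul]
  rw [← (key ε hε).2, ← (key R (hε.trans_le hR)).2, ← integral_sub (key ε hε).1
    (key R (hε.trans_le hR)).1]
  have e4 : ∀ r, r ^ (-(N : ℝ) - 1) * ∫ x, v x * fracLap N α (radialBump N) (r⁻¹ • (x - x₀)) =
      ∫ x, v x * (r ^ (-(N : ℝ) - 1) * fracLap N α (radialBump N) (r⁻¹ • (x - x₀))) := fun r => by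
    rw [← integral_const_mul]; congr 1; ext x; ring
  simp only [e4]
  rw [integral_integral_swap hp]
  congr 1; ext x
  rw [integral_const_mul, setIntegral_dilate_Ioc hN hα1 hα2 hε hR, mul_sub]

lemma integrable_dilate_outer (hN : 3 ≤ N) (hα1 : 0 < α) (hα2 : α < 2) {ε R : ℝ} (hε : 0 < ε)
    (x₀ : 𝔼 N) {v : 𝔼 N → ℝ} (hv : Measurable v) {M : ℝ} (hM : ∀ x, |v x| ≤ M) :
    IntegrableOn (fun r : ℝ => r ^ (-(N : ℝ) - 1) *
        ∫ x, v x * fracLap N α (radialBump N) (r⁻¹ • (x - x₀))) (Set.Ioc ε R) := by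
  refine (integrable_dilate_prod (R := R) hN hα1 hα2 hε x₀ hv hM).integral_prod_left.congr
    (ae_of_all _ fun r => ?_)
  simp only
  rw [← integral_const_mul]; congr 1; ext x; ring

/-- The Riesz kernel. -/
def rieszKernel (N : ℕ) (α : ℝ) (x : 𝔼 N) : ℝ := ‖x‖ ^ (-((N : ℝ) - α))

/-- The normalising constant relating `rieszKernel` to the superposition of dilates of
`radialBump`. -/
def bumpConst (N : ℕ) (α : ℝ) : ℝ :=
  ∫ r in Set.Ioi (0 : ℝ), r ^ (α - N - 1) * expNegInvGlue (1 - r⁻¹ ^ 2)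

lemma measurable_rieszKernel : Measurable (rieszKernel N α) := by
  unfold rieszKernel; fun_prop

lemma rieszKernel_nonneg (x : 𝔼 N) : 0 ≤ rieszKernel N α x := by unfold rieszKernel; positivity

lemma rieszKernel_le_one (hN : 3 ≤ N) (hα2 : α < 2) {x : 𝔼 N} (hx : 1 ≤ ‖x‖) :
    rieszKernel N α x ≤ 1 := by
  have hN' : (3 : ℝ) ≤ N := by exact_mod_cast hN
  exact Real.rpow_le_one_of_one_le_of_nonpos hx (by linarith)

lemma integrableOn_rieszKernel_ball (hN : 3 ≤ N) (hα1 : 0 < α) (R : ℝ) :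
    IntegrableOn (rieszKernel N α) (Metric.ball 0 R) := by
  have hfr : Module.finrank ℝ (𝔼 N) = N := by simp
  refine integrableOn_ball_of_norm_le_rpow (C := 1) (α := N - α) (by rw [hfr]; omega)
      (by rw [hfr]; linarith) (ae_of_all _ fun z => ?_) measurable_rieszKernel.aestronglyMeasurable
  rw [one_mul, Real.norm_of_nonneg (rieszKernel_nonneg z), rieszKernel]

lemma measurable_expNegInvGlue : Measurable expNegInvGlue :=
  (expNegInvGlue.contDiff (n := 0)).continuous.measurable

lemma expNegInvGlue_le_one (t : ℝ) : expNegInvGlue t ≤ 1 := by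
  unfold expNegInvGlue
  split_ifs with h
  · exact zero_le_one
  · exact Real.exp_le_one_iff.2 (by simpa using (not_le.1 h).le)

lemma integrableOn_bumpConst (hN : 3 ≤ N) (hα2 : α < 2) :
    IntegrableOn (fun r : ℝ => r ^ (α - N - 1) * expNegInvGlue (1 - r⁻¹ ^ 2)) (Set.Ioi 0) := by
  have hN' : (3 : ℝ) ≤ N := by exact_mod_cast hN
  have hm : Measurable (fun r : ℝ => r ^ (α - N - 1) * expNegInvGlue (1 - r⁻¹ ^ 2)) := by
    have h1 : Measurable fun r : ℝ => 1 - r⁻¹ ^ 2 := by fun_prop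
    have h2 : Measurable fun r : ℝ => r ^ (α - N - 1) := by fun_prop
    exact h2.mul (measurable_expNegInvGlue.comp h1)
  have h1 : IntegrableOn (fun r : ℝ => r ^ (α - N - 1) * expNegInvGlue (1 - r⁻¹ ^ 2))
      (Set.Ioi 1) := by
    refine Integrable.mono' (integrableOn_Ioi_rpow_of_lt (a := α - N - 1) (by linarith) one_pos)
      hm.aestronglyMeasurable ((ae_restrict_iff' measurableSet_Ioi).2 (ae_of_all _ fun r hr => ?_))
    have hr' : 0 < r := zero_lt_one.trans hr
    rw [norm_mul, Real.norm_of_nonneg (by positivity), Real.norm_of_nonneg (expNegInvGlue.nonneg _)]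
    exact mul_le_of_le_one_right (by positivity) (expNegInvGlue_le_one _)
  have h2 : IntegrableOn (fun r : ℝ => r ^ (α - N - 1) * expNegInvGlue (1 - r⁻¹ ^ 2))
      (Set.Ioc 0 1) := by
    refine (integrableOn_zero).congr_fun (fun r hr => ?_) measurableSet_Ioc
    have : 1 ≤ r⁻¹ := (one_le_inv₀ hr.1).2 hr.2
    rw [expNegInvGlue.zero_of_nonpos (by nlinarith), mul_zero]
  rw [← Set.Ioc_union_Ioi_eq_Ioi (zero_le_one (α := ℝ))]
  exact h2.union h1

lemma bumpConst_pos (hN : 3 ≤ N) (hα2 : α < 2) : 0 < bumpConst N α := by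
  rw [bumpConst, setIntegral_pos_iff_support_of_nonneg_ae _ (integrableOn_bumpConst hN hα2)]
  · refine lt_of_lt_of_le ?_ (measure_mono (s := Set.Ioo (1 : ℝ) 2) ?_)
    · simp
    · intro r hr
      have hr' : 0 < r := zero_lt_one.trans hr.1
      refine ⟨?_, hr'⟩
      have h1 : r⁻¹ < 1 := inv_lt_one_of_one_lt₀ hr.1
      have h2 : 0 < r⁻¹ := by positivity
      have := expNegInvGlue.pos_of_pos (x := 1 - r⁻¹ ^ 2) (by nlinarith)
      exact (mul_pos (by positivity) this).ne'
  · refine (ae_restrict_iff' measurableSet_Ioi).2 (ae_of_all _ fun r hr => ?_)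
    have hr' : (0 : ℝ) < r := hr
    exact mul_nonneg (by positivity) (expNegInvGlue.nonneg _)

lemma superposition_aux {x : 𝔼 N} (hx : x ≠ 0) {r : ℝ} (hr : 0 < r) :
    (‖x‖ * r) ^ (α - N - 1) * radialBump N ((‖x‖ * r)⁻¹ • x) =
      ‖x‖ ^ (α - N - 1) * (r ^ (α - N - 1) * expNegInvGlue (1 - r⁻¹ ^ 2)) := by
  have hx0 : 0 < ‖x‖ := norm_pos_iff.2 hx
  rw [Real.mul_rpow hx0.le hr.le, radialBump, norm_smul, norm_inv, norm_mul, norm_norm,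
    Real.norm_of_nonneg hr.le, mul_inv, mul_right_comm _ _ ‖x‖,
    inv_mul_cancel₀ hx0.ne', one_mul, mul_assoc]

lemma integrableOn_superposition (hN : 3 ≤ N) (hα2 : α < 2) {x : 𝔼 N} (hx : x ≠ 0) :
    IntegrableOn (fun r : ℝ => r ^ (α - N - 1) * radialBump N (r⁻¹ • x)) (Set.Ioi 0) := by
  have hx0 : 0 < ‖x‖ := norm_pos_iff.2 hx
  have h := integrableOn_Ioi_comp_mul_left_iff
    (fun r : ℝ => r ^ (α - N - 1) * radialBump N (r⁻¹ • x)) 0 hx0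
  rw [mul_zero] at h
  rw [← h]
  refine IntegrableOn.congr_fun
    (Integrable.const_mul (integrableOn_bumpConst hN hα2) (‖x‖ ^ (α - N - 1)))
    (fun r hr => ?_) measurableSet_Ioi
  exact (superposition_aux hx hr).symm

/-- The Riesz kernel is a superposition of dilates of `radialBump`. -/
lemma integral_superposition {x : 𝔼 N} (hx : x ≠ 0) :
    ∫ r in Set.Ioi (0 : ℝ), r ^ (α - N - 1) * radialBump N (r⁻¹ • x) =
      bumpConst N α * rieszKernel N α x := by
  have hx0 : 0 < ‖x‖ := norm_pos_iff.2 hx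
  have h := integral_comp_mul_left_Ioi'
    (fun r : ℝ => r ^ (α - N - 1) * radialBump N (r⁻¹ • x)) 0 hx0
  rw [mul_zero] at h
  rw [← h, setIntegral_congr_fun measurableSet_Ioi fun r hr => superposition_aux hx hr,
    integral_const_mul, smul_eq_mul, ← bumpConst, rieszKernel, Real.rpow_sub_one hx0.ne',
    neg_sub]
  field_simp

lemma ae_ne_zero_euclidean (hN : 3 ≤ N) : ∀ᵐ x : 𝔼 N, x ≠ 0 := by
  have hNT : Nontrivial (𝔼 N) := by
    have : Nonempty (Fin N) := ⟨⟨0, by omega⟩⟩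
    infer_instance
  rw [ae_iff]; simp

lemma integral_superposition_mul (hN : 3 ≤ N) (hα2 : α < 2) {g : 𝔼 N → ℝ} (hg : Measurable g)
    (hgi : Integrable (fun x => rieszKernel N α x * g x)) :
    IntegrableOn (fun r : ℝ => r ^ (α - N - 1) * ∫ x, radialBump N (r⁻¹ • x) * g x) (Set.Ioi 0) ∧
    ∫ r in Set.Ioi 0, r ^ (α - N - 1) * ∫ x, radialBump N (r⁻¹ • x) * g x =
      bumpConst N α * ∫ x, rieszKernel N α x * g x := by
  have hae := ae_ne_zero_euclidean hN
  have hm : Measurable (fun p : ℝ × 𝔼 N => (p.1 ^ (α - N - 1) * radialBump N (p.1⁻¹ • p.2)) * g p.2) := by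
    have h1 : Measurable fun p : ℝ × 𝔼 N => p.1 ^ (α - N - 1) := by fun_prop
    have h2 : Measurable fun p : ℝ × 𝔼 N => p.1⁻¹ • p.2 := by fun_prop
    exact (h1.mul ((radialBump_contDiff N).continuous.measurable.comp h2)).mul
      (hg.comp measurable_snd)
  have hp : Integrable (fun p : ℝ × 𝔼 N =>
      (p.1 ^ (α - N - 1) * radialBump N (p.1⁻¹ • p.2)) * g p.2)
      ((volume.restrict (Set.Ioi 0)).prod volume) := by
    rw [integrable_prod_iff' hm.aestronglyMeasurable]
    constructor
    · filter_upwards [hae] with x hx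
      exact Integrable.mul_const (integrableOn_superposition hN hα2 hx) (g x)
    · refine (hgi.abs.const_mul (bumpConst N α)).congr ?_
      filter_upwards [hae] with x hx
      have e : ∀ r ∈ Set.Ioi (0 : ℝ), ‖(r ^ (α - N - 1) * radialBump N (r⁻¹ • x)) * g x‖ =
          (r ^ (α - N - 1) * radialBump N (r⁻¹ • x)) * |g x| := fun r hr => by
        have hr' : (0 : ℝ) < r := hr
        rw [norm_mul, Real.norm_of_nonneg (mul_nonneg (by positivity) (radialBump_nonneg _)),
          Real.norm_eq_abs]
      rw [setIntegral_congr_fun measurableSet_Ioi e, integral_mul_const, integral_superposition hx,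
        abs_mul, abs_of_nonneg (rieszKernel_nonneg x), mul_assoc]
  have e2 : ∀ r : ℝ, r ^ (α - N - 1) * ∫ x, radialBump N (r⁻¹ • x) * g x =
      ∫ x, (r ^ (α - N - 1) * radialBump N (r⁻¹ • x)) * g x := fun r => by
    rw [← integral_const_mul]; congr 1; ext x; ring
  simp only [e2]
  refine ⟨hp.integral_prod_left, ?_⟩
  rw [integral_integral_swap hp, ← integral_const_mul]
  refine integral_congr_ae ?_
  filter_upwards [hae] with x hx
  rw [integral_mul_const, integral_superposition hx, mul_assoc]

lemma integrable_riesz_mul_fracKernel (hN : 3 ≤ N) (hα1 : 0 < α) (hα2 : α < 2) {θ : 𝔼 N → ℝ}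
    (hθ : ContDiff ℝ (⊤ : ℕ∞) θ) (hc : HasCompactSupport θ) :
    Integrable (fun p : 𝔼 N × 𝔼 N => rieszKernel N α p.1 * fracKernel α θ p.1 p.2)
      (volume.prod volume) :=
  integrable_mul_fracKernel hN hα1 hα2 hθ hc measurable_rieszKernel
    (integrableOn_rieszKernel_ball hN hα1 1) (G := 1) fun x hx => by
      rw [abs_of_nonneg (rieszKernel_nonneg x)]; exact rieszKernel_le_one hN hα2 hx

lemma iUnion_Ioc_exhaust : ⋃ n : ℕ, Set.Ioc (1 / ((n : ℝ) + 1)) ((n : ℝ) + 1) = Set.Ioi 0 := by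
  ext r
  simp only [Set.mem_iUnion, Set.mem_Ioc, Set.mem_Ioi]
  constructor
  · rintro ⟨n, h1, -⟩
    exact lt_trans (by positivity) h1
  · intro hr
    obtain ⟨n, hn⟩ := exists_nat_one_div_lt hr
    obtain ⟨m, hm⟩ := exists_nat_ge r
    refine ⟨max n m, lt_of_le_of_lt ?_ hn, hm.trans ?_⟩
    · apply one_div_le_one_div_of_le (by positivity)
      gcongr
      exact le_max_left n m
    · have : (m : ℝ) ≤ (max n m : ℕ) := by exact_mod_cast le_max_right n m
      linarith

lemma monotone_Ioc_exhaust :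
    Monotone fun n : ℕ => Set.Ioc (1 / ((n : ℝ) + 1)) ((n : ℝ) + 1) := by
  intro n m h
  have h' : (n : ℝ) ≤ m := by exact_mod_cast h
  apply Set.Ioc_subset_Ioc
  · apply one_div_le_one_div_of_le (by positivity); linarith
  · linarith

lemma rpow_mul_integral_bump (hN : 3 ≤ N) (hα1 : 0 < α) (hα2 : α < 2) {θ : 𝔼 N → ℝ}
    (hθ : ContDiff ℝ (⊤ : ℕ∞) θ) (hc : HasCompactSupport θ) {r : ℝ} (hr : 0 < r) :
    r ^ (α - N - 1) * ∫ x, radialBump N (r⁻¹ • x) * fracLap N α θ x =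
      r ^ (-(N : ℝ) - 1) * ∫ x, θ x * fracLap N α (radialBump N) (r⁻¹ • (x - 0)) := by
  have hd : ContDiff ℝ (⊤ : ℕ∞) (fun x : 𝔼 N => radialBump N (r⁻¹ • x)) :=
    (radialBump_contDiff N).comp (contDiff_const_smul _)
  have hcd : HasCompactSupport (fun x : 𝔼 N => radialBump N (r⁻¹ • x)) :=
    (radialBump_hasCompactSupport N).comp_smul (inv_ne_zero hr.ne')
  rw [integral_mul_fracLap_comm hN hα1 hα2 hθ hc hd hcd]
  have e : ∀ x, fracLap N α (fun x : 𝔼 N => radialBump N (r⁻¹ • x)) x =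
      r ^ (-α) * fracLap N α (radialBump N) (r⁻¹ • (x - 0)) := fun x => by
    rw [← fracLap_scale _ hr]; simp only [sub_zero]
  have e2 : ∀ x, θ x * (r ^ (-α) * fracLap N α (radialBump N) (r⁻¹ • (x - 0))) =
    r ^ (-α) * (θ x * fracLap N α (radialBump N) (r⁻¹ • (x - 0))) := fun x => by ring
  simp only [e, e2]
  rw [integral_const_mul, ← mul_assoc, ← Real.rpow_add hr]
  congr 2; ring

lemma tendsto_one_div_nat_add_one : Tendsto (fun n : ℕ => 1 / ((n : ℝ) + 1)) atTop (𝓝 0) :=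
  tendsto_one_div_add_atTop_nhds_zero_nat

/-- The Riesz kernel is, up to a constant, a fundamental solution at the origin. -/
lemma bumpConst_mul_integral_riesz (hN : 3 ≤ N) (hα1 : 0 < α) (hα2 : α < 2) {θ : 𝔼 N → ℝ}
    (hθ : ContDiff ℝ (⊤ : ℕ∞) θ) (hc : HasCompactSupport θ) :
    bumpConst N α * ∫ x, rieszKernel N α x * fracLap N α θ x =
      (∫ y, smoothedDelta N α y) * θ 0 := by
  have hae := ae_ne_zero_euclidean hN
  obtain ⟨B, hB⟩ := hc.exists_bound_of_continuous hθ.continuous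
  have hP := integrable_smoothedDelta (N := N) hN hα1 hα2
  set F : ℝ → ℝ := fun r => r ^ (α - N - 1) * ∫ x, radialBump N (r⁻¹ • x) * fracLap N α θ x
  have hF : IntegrableOn F (Set.Ioi 0) ∧ ∫ r in Set.Ioi 0, F r =
      bumpConst N α * ∫ x, rieszKernel N α x * fracLap N α θ x :=
    integral_superposition_mul hN hα2 (continuous_fracLap hN hα1 hα2 hθ hc).measurable
      (integrable_mul_fracLap (integrable_riesz_mul_fracKernel hN hα1 hα2 hθ hc))
  have lim1 : Tendsto (fun n : ℕ => ∫ r in Set.Ioc (1 / ((n : ℝ) + 1)) ((n : ℝ) + 1), F r) atTop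
      (𝓝 (bumpConst N α * ∫ x, rieszKernel N α x * fracLap N α θ x)) := by
    rw [← hF.2, ← iUnion_Ioc_exhaust]
    exact tendsto_setIntegral_of_monotone (fun n => measurableSet_Ioc) monotone_Ioc_exhaust
      (by rw [iUnion_Ioc_exhaust]; exact hF.1)
  have e : ∀ n : ℕ, ∫ r in Set.Ioc (1 / ((n : ℝ) + 1)) ((n : ℝ) + 1), F r =
      (∫ y, θ (0 + (1 / ((n : ℝ) + 1)) • y) * smoothedDelta N α y) -
        ∫ y, θ (0 + ((n : ℝ) + 1) • y) * smoothedDelta N α y := by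
    intro n
    have hn : 0 < 1 / ((n : ℝ) + 1) := by positivity
    rw [← integral_dilate_test hN hα1 hα2 hn ?_ 0 hθ.continuous.measurable hB]
    · refine setIntegral_congr_fun measurableSet_Ioc fun r hr => ?_
      exact rpow_mul_integral_bump hN hα1 hα2 hθ hc (hn.trans hr.1)
    · rw [div_le_iff₀ (by positivity)]
      have : (0 : ℝ) ≤ n := by positivity
      nlinarith
  have lim2 : Tendsto (fun n : ℕ => ∫ y, θ (0 + (1 / ((n : ℝ) + 1)) • y) * smoothedDelta N α y)
      atTop (𝓝 (∫ y, θ 0 * smoothedDelta N α y)) := by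
    refine tendsto_integral_of_dominated_convergence (fun y => B * |smoothedDelta N α y|)
      (fun n => ?_) (hP.abs.const_mul B) (fun n => ae_of_all _ fun y => ?_)
      (ae_of_all _ fun y => ?_)
    · have : Continuous fun y : 𝔼 N => θ (0 + (1 / ((n : ℝ) + 1)) • y) :=
        hθ.continuous.comp (by fun_prop)
      exact this.aestronglyMeasurable.mul hP.1
    · rw [norm_mul]
      exact mul_le_mul_of_nonneg_right (hB _) (norm_nonneg _)
    · refine Tendsto.mul_const _ ((hθ.continuous.tendsto 0).comp ?_)
      have := (tendsto_one_div_nat_add_one.smul_const y).const_add (0 : 𝔼 N)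
      simpa using this
  have lim3 : Tendsto (fun n : ℕ => ∫ y, θ (0 + ((n : ℝ) + 1) • y) * smoothedDelta N α y)
      atTop (𝓝 (∫ y : 𝔼 N, (0 : ℝ))) := by
    obtain ⟨R, hR0, hR⟩ := hc.isBounded.exists_pos_norm_le
    have hθR : ∀ y, R < ‖y‖ → θ y = 0 := fun y hy => by
      by_contra h
      exact absurd (hR y (subset_tsupport _ h)) (not_le.2 hy)
    refine tendsto_integral_of_dominated_convergence (fun y => B * |smoothedDelta N α y|)
      (fun n => ?_) (hP.abs.const_mul B) (fun n => ae_of_all _ fun y => ?_) ?_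
    · have : Continuous fun y : 𝔼 N => θ (0 + ((n : ℝ) + 1) • y) :=
        hθ.continuous.comp (by fun_prop)
      exact this.aestronglyMeasurable.mul hP.1
    · rw [norm_mul]
      exact mul_le_mul_of_nonneg_right (hB _) (norm_nonneg _)
    · filter_upwards [hae] with y hy
      have hy0 : 0 < ‖y‖ := norm_pos_iff.2 hy
      apply tendsto_const_nhds.congr'
      obtain ⟨m, hm⟩ := exists_nat_gt (R / ‖y‖)
      filter_upwards [eventually_ge_atTop m] with n hn
      have hn' : (m : ℝ) ≤ n := by exact_mod_cast hn
      rw [hθR, zero_mul]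
      rw [zero_add, norm_smul, Real.norm_of_nonneg (by positivity)]
      rw [div_lt_iff₀ hy0] at hm
      nlinarith
  simp only [e] at lim1
  have := tendsto_nhds_unique lim1 (lim2.sub lim3)
  rw [this, integral_const_mul]
  simp [mul_comm]

end

section
variable {N : ℕ} {α : ℝ}

lemma locallyIntegrable_rieszKernel (hN : 3 ≤ N) (hα1 : 0 < α) :
    LocallyIntegrable (rieszKernel N α) := by
  rw [locallyIntegrable_iff]
  intro K hK
  obtain ⟨R, hR⟩ := hK.isBounded.subset_ball 0
  exact (integrableOn_rieszKernel_ball hN hα1 R).mono_set hR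

lemma rieszKernel_strictAnti (hN : 3 ≤ N) (hα2 : α < 2) {x y : 𝔼 N} (hx : x ≠ 0)
    (h : ‖x‖ < ‖y‖) : rieszKernel N α y < rieszKernel N α x := by
  have hN' : (3 : ℝ) ≤ N := by exact_mod_cast hN
  exact Real.rpow_lt_rpow_of_neg (norm_pos_iff.2 hx) h (by linarith)

lemma rieszKernel_anti (hN : 3 ≤ N) (hα2 : α < 2) {x y : 𝔼 N} (hx : x ≠ 0)
    (h : ‖x‖ ≤ ‖y‖) : rieszKernel N α y ≤ rieszKernel N α x := by
  have hN' : (3 : ℝ) ≤ N := by exact_mod_cast hN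
  exact Real.rpow_le_rpow_of_nonpos (norm_pos_iff.2 hx) h (by linarith)

lemma integral_riesz_secondDiff_neg (hN : 3 ≤ N) (hα1 : 0 < α) (hα2 : α < 2) {z : 𝔼 N}
    (hz : z ≠ 0) : ∫ x, rieszKernel N α x * secondDiff (radialBump N) x z < 0 := by
  set k := rieszKernel N α with hk
  set ψ := radialBump N with hψ
  have hψc : Continuous ψ := (radialBump_contDiff N).continuous
  have hi : ∀ a : 𝔼 N, Integrable (fun x => k x * ψ (x + a)) := fun a => by
    have hs : HasCompactSupport (fun x => ψ (x + a)) :=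
      (radialBump_hasCompactSupport N).comp_homeomorph (Homeomorph.addRight a)
    exact (locallyIntegrable_rieszKernel hN hα1).integrable_smul_right_of_hasCompactSupport
      (hψc.comp (by fun_prop)) hs
  have i0 : Integrable (fun x => k x * ψ x) := by simpa using hi 0
  have i1 := hi z
  have i2 : Integrable (fun x => k x * ψ (x - z)) := by simpa [sub_eq_add_neg] using hi (-z)
  have i3 : Integrable (fun x => k (x + z) * ψ x) := by simpa using i2.comp_add_right z
  have i4 : Integrable (fun x => k (x + z) * ψ (x + z)) := i0.comp_add_right z
  have e3 : ∫ x, k (x + z) * ψ x = ∫ x, k x * ψ (x - z) := by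
    have := integral_add_right_eq_self (μ := volume) (fun x => k x * ψ (x - z)) z
    simpa using this
  have e4 : ∫ x, k (x + z) * ψ (x + z) = ∫ x, k x * ψ x :=
    integral_add_right_eq_self (μ := volume) (fun x => k x * ψ x) z
  have j1 : Integrable (fun x => (k x - k (x + z)) * (ψ x - ψ (x + z))) :=
    ((i0.sub i1).sub (i3.sub i4)).congr (ae_of_all _ fun x => by simp; ring)
  have e : ∫ x, k x * secondDiff ψ x z = -∫ x, (k x - k (x + z)) * (ψ x - ψ (x + z)) := by
    have f1 : ∀ x, k x * secondDiff ψ x z = (k x * ψ (x + z) + k x * ψ (x - z)) - 2 * (k x * ψ x) :=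
      fun x => by unfold secondDiff; ring
    have f2 : ∀ x, (k x - k (x + z)) * (ψ x - ψ (x + z)) =
        (k x * ψ x - k x * ψ (x + z)) - (k (x + z) * ψ x - k (x + z) * ψ (x + z)) := fun x => by ring
    have s1 : Integrable (fun x => k x * ψ x - k x * ψ (x + z)) := i0.sub i1
    have s2 : Integrable (fun x => k (x + z) * ψ x - k (x + z) * ψ (x + z)) := i3.sub i4
    have s3 : Integrable (fun x => k x * ψ (x + z) + k x * ψ (x - z)) := i1.add i2
    simp only [f1, f2]
    rw [integral_sub s1 s2, integral_sub i0 i1, integral_sub i3 i4,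
      integral_sub s3 (i0.const_mul 2), integral_add i1 i2, integral_const_mul, e3, e4]
    ring
  rw [e, neg_lt_zero]
  have hae := ae_ne_zero_euclidean hN
  have hae2 : ∀ᵐ x : 𝔼 N, x + z ≠ 0 := by
    have := (measurePreserving_add_right (volume : Measure (𝔼 N)) z).quasiMeasurePreserving.ae hae
    exact this
  rw [integral_pos_iff_support_of_nonneg_ae _ j1]
  · have hz0 : 0 < ‖z‖ := norm_pos_iff.2 hz
    have hsub : Metric.ball (0 : 𝔼 N) (min 1 (‖z‖ / 2)) \ {0} ⊆
        Function.support (fun x => (k x - k (x + z)) * (ψ x - ψ (x + z))) := by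
      rintro x ⟨hx, hx0⟩
      rw [mem_ball_zero_iff, lt_min_iff] at hx
      have hx0' : x ≠ 0 := hx0
      have hlt : ‖x‖ < ‖x + z‖ := by
        have := norm_sub_norm_le z (-x)
        rw [sub_neg_eq_add, norm_neg, add_comm z x] at this
        linarith
      exact (mul_pos (sub_pos.2 (rieszKernel_strictAnti hN hα2 hx0' hlt))
        (sub_pos.2 (radialBump_strictAnti hx.1 hlt))).ne'
    refine lt_of_lt_of_le ?_ (measure_mono hsub)
    rw [measure_sdiff_null]
    · exact Metric.measure_ball_pos _ _ (lt_min one_pos (by positivity))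
    · have := hae; rw [ae_iff] at this; simpa using this
  · filter_upwards [hae, hae2] with x h1 h2
    rcases le_total ‖x‖ ‖x + z‖ with h | h
    · exact mul_nonneg (sub_nonneg.2 (rieszKernel_anti hN hα2 h1 h)) (sub_nonneg.2 (radialBump_anti h))
    · exact mul_nonneg_of_nonpos_of_nonpos (sub_nonpos.2 (rieszKernel_anti hN hα2 h2 h))
        (sub_nonpos.2 (radialBump_anti h))

lemma integral_riesz_fracLap_bump_neg (hN : 3 ≤ N) (hα1 : 0 < α) (hα2 : α < 2) :
    ∫ x, rieszKernel N α x * fracLap N α (radialBump N) x < 0 := by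
  have hp := integrable_riesz_mul_fracKernel hN hα1 hα2 (radialBump_contDiff N)
    (radialBump_hasCompactSupport N)
  rw [integral_mul_fracLap hp]
  have hc := fracLapCoeff_pos (N := N) hα1 hα2
  refine mul_neg_of_pos_of_neg (by positivity) ?_
  rw [← neg_pos, ← integral_neg]
  have hae := ae_ne_zero_euclidean hN
  have hneg : ∀ z : 𝔼 N, z ≠ 0 → 0 < -((∫ x, rieszKernel N α x * secondDiff (radialBump N) x z) /
      ‖z‖ ^ ((N : ℝ) + α)) := fun z hz => by
    have hz0 : 0 < ‖z‖ := norm_pos_iff.2 hz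
    have := integral_riesz_secondDiff_neg hN hα1 hα2 hz
    rw [← neg_div]
    exact div_pos (neg_pos.2 this) (by positivity)
  rw [integral_pos_iff_support_of_nonneg_ae]
  · refine lt_of_lt_of_le (Metric.measure_ball_pos volume (0 : 𝔼 N) one_pos) ?_
    refine measure_mono_ae ?_
    filter_upwards [hae] with z hz _
    exact (hneg z hz).ne'
  · filter_upwards [hae] with z hz using (hneg z hz).le
  · refine (hp.integral_prod_right.congr (ae_of_all _ fun z => ?_)).neg
    simp only [fracKernel]
    rw [← integral_div]
    congr 1; ext x; ring

lemma integral_smoothedDelta_neg (hN : 3 ≤ N) (hα1 : 0 < α) (hα2 : α < 2) :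
    ∫ y, smoothedDelta N α y < 0 := by
  have h := bumpConst_mul_integral_riesz hN hα1 hα2 (radialBump_contDiff N)
    (radialBump_hasCompactSupport N)
  have h1 := mul_neg_of_pos_of_neg (bumpConst_pos (α := α) hN hα2)
    (integral_riesz_fracLap_bump_neg hN hα1 hα2)
  rw [h] at h1
  exact neg_of_mul_neg_left h1 (radialBump_nonneg _)

/-- A positive multiple of the Riesz kernel is a fundamental solution of `-Δ^{α/2}`. -/
lemma exists_fundamental_const (hN : 3 ≤ N) (hα1 : 0 < α) (hα2 : α < 2) :
    ∃ c : ℝ, 0 < c ∧ ∀ θ : 𝔼 N → ℝ, ContDiff ℝ (⊤ : ℕ∞) θ → HasCompactSupport θ → ∀ y,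
      c * ∫ x, rieszKernel N α (x - y) * fracLap N α θ x = -θ y := by
  have h1 := bumpConst_pos (α := α) hN hα2
  have h2 := integral_smoothedDelta_neg hN hα1 hα2
  refine ⟨bumpConst N α / (-∫ y, smoothedDelta N α y), div_pos h1 (neg_pos.2 h2),
    fun θ hθ hc y => ?_⟩
  have hc' : HasCompactSupport (fun x => θ (x + y)) :=
    hc.comp_homeomorph (Homeomorph.addRight y)
  have h3 := bumpConst_mul_integral_riesz hN hα1 hα2 (hθ.comp (contDiff_id.add contDiff_const)) hc'
  have e1 : ∀ x, fracLap N α (fun x => θ (x + y)) x = fracLap N α θ (x + y) := fun x => by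
    have := fracLap_scale (α := α) θ one_pos (-y) x
    simpa using this
  have e2 := integral_add_right_eq_self (μ := volume)
    (fun x => rieszKernel N α (x - y) * fracLap N α θ x) y
  simp only [add_sub_cancel_right] at e2
  have h4 : bumpConst N α * ∫ x, rieszKernel N α x * fracLap N α (fun x => θ (x + y)) x =
    (∫ y, smoothedDelta N α y) * θ (0 + y) := h3
  simp only [e1] at h4
  rw [e2, zero_add] at h4
  rw [div_mul_eq_mul_div, h4]
  field_simp [h2.ne]

end

section
variable {N : ℕ} {α : ℝ}

lemma lintegral_superposition_le (hN : 3 ≤ N) (hα1 : 0 < α) (hα2 : α < 2)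
    {u f : 𝔼 N → ℝ} (hu : Measurable u) {M : ℝ} (hM : ∀ x, |u x| ≤ M) (hf0 : ∀ x, 0 ≤ f x)
    (hfl : LocallyIntegrable f)
    (hw : ∀ θ : 𝔼 N → ℝ, ContDiff ℝ (⊤ : ℕ∞) θ → HasCompactSupport θ →
      ∫ x, u x * fracLap N α θ x = -∫ x, f x * θ x) (x₀ : 𝔼 N) {ε R : ℝ} (hε : 0 < ε) (hR : ε ≤ R) :
    ∫⁻ r in Set.Ioc ε R, ∫⁻ x, ENNReal.ofReal
      (r ^ (α - N - 1) * radialBump N (r⁻¹ • (x - x₀)) * f x) ≤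
      ENNReal.ofReal (2 * M * ∫ y, |smoothedDelta N α y|) := by
  have hP := integrable_smoothedDelta (N := N) hN hα1 hα2
  have hsupp : ∀ r : ℝ, 0 < r → HasCompactSupport (fun x => radialBump N (r⁻¹ • (x - x₀))) :=
    fun r hr => ((radialBump_hasCompactSupport N).comp_smul (inv_ne_zero hr.ne')).comp_homeomorph
      (Homeomorph.subRight x₀)
  have hcd : ∀ r : ℝ, ContDiff ℝ (⊤ : ℕ∞) (fun x => radialBump N (r⁻¹ • (x - x₀))) := fun r =>
    (radialBump_contDiff N).comp ((contDiff_id.sub contDiff_const).const_smul _)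
  have hid : ∀ r : ℝ, 0 < r → ∫ x, r ^ (α - N - 1) * radialBump N (r⁻¹ • (x - x₀)) * f x =
      -(r ^ (-(N : ℝ) - 1) * ∫ x, u x * fracLap N α (radialBump N) (r⁻¹ • (x - x₀))) := by
    intro r hr
    have h1 := hw _ (hcd r) (hsupp r hr)
    simp only [fracLap_scale _ hr] at h1
    have e1 : ∀ x, u x * (r ^ (-α) * fracLap N α (radialBump N) (r⁻¹ • (x - x₀))) =
      r ^ (-α) * (u x * fracLap N α (radialBump N) (r⁻¹ • (x - x₀))) := fun x => by ring
    have e2 : ∀ x, r ^ (α - N - 1) * radialBump N (r⁻¹ • (x - x₀)) * f x =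
      r ^ (α - N - 1) * (f x * radialBump N (r⁻¹ • (x - x₀))) := fun x => by ring
    simp only [e1] at h1
    rw [integral_const_mul] at h1
    simp only [e2]
    have h3 := neg_eq_iff_eq_neg.2 h1
    rw [integral_const_mul, ← h3]
    have : r ^ (-(N : ℝ) - 1) = r ^ (α - N - 1) * r ^ (-α) := by
      rw [← Real.rpow_add hr]; congr 1; ring
    rw [this]; ring
  have hrint : ∀ r : ℝ, 0 < r →
      Integrable (fun x => r ^ (α - N - 1) * radialBump N (r⁻¹ • (x - x₀)) * f x) := fun r hr => by
    have := (hfl.integrable_smul_right_of_hasCompactSupport (hcd r).continuous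
      (hsupp r hr)).const_mul (r ^ (α - N - 1))
    refine this.congr (ae_of_all _ fun x => ?_)
    simp only [smul_eq_mul]; ring
  have hin : ∀ r ∈ Set.Ioc ε R, ∫⁻ x, ENNReal.ofReal
      (r ^ (α - N - 1) * radialBump N (r⁻¹ • (x - x₀)) * f x) =
      ENNReal.ofReal
        (-(r ^ (-(N : ℝ) - 1) * ∫ x, u x * fracLap N α (radialBump N) (r⁻¹ • (x - x₀)))) := by
    intro r hr
    have hr' : 0 < r := hε.trans hr.1
    rw [← hid r hr', ofReal_integral_eq_lintegral_ofReal (hrint r hr')]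
    exact ae_of_all _ fun x =>
      mul_nonneg (mul_nonneg (by positivity) (radialBump_nonneg _)) (hf0 x)
  have hneg : IntegrableOn (fun r : ℝ => -(r ^ (-(N : ℝ) - 1) *
      ∫ x, u x * fracLap N α (radialBump N) (r⁻¹ • (x - x₀)))) (Set.Ioc ε R) :=
    (integrable_dilate_outer hN hα1 hα2 hε x₀ hu hM).neg
  rw [setLIntegral_congr_fun measurableSet_Ioc hin, ← ofReal_integral_eq_lintegral_ofReal hneg,
    integral_neg,
    integral_dilate_test hN hα1 hα2 hε hR x₀ hu hM]
  · apply ENNReal.ofReal_le_ofReal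
    have b : ∀ s : ℝ, |∫ y : 𝔼 N, u (x₀ + s • y) * smoothedDelta N α y| ≤
        M * ∫ y, |smoothedDelta N α y| := fun s => by
      rw [← integral_const_mul, ← Real.norm_eq_abs]
      refine norm_integral_le_of_norm_le (hP.abs.const_mul M) (ae_of_all _ fun y : 𝔼 N => ?_)
      rw [norm_mul]
      exact mul_le_mul_of_nonneg_right (hM _) (norm_nonneg _)
    have b1 := abs_le.1 (b ε)
    have b2 := abs_le.1 (b R)
    linarith
  · refine (ae_restrict_iff' measurableSet_Ioc).2 (ae_of_all _ fun r hr => ?_)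
    have hr' : 0 < r := hε.trans hr.1
    simp only [Pi.zero_apply]
    rw [← hid r hr']
    exact integral_nonneg fun x =>
      mul_nonneg (mul_nonneg (by positivity) (radialBump_nonneg _)) (hf0 x)

/-- The Riesz potential of the right-hand side is bounded for bounded weak solutions. -/
lemma riesz_potential_le (hN : 3 ≤ N) (hα1 : 0 < α) (hα2 : α < 2)
    {u f : 𝔼 N → ℝ} (hu : Measurable u) {M : ℝ} (hM : ∀ x, |u x| ≤ M) (hf0 : ∀ x, 0 ≤ f x)
    (hf : Measurable f) (hfl : LocallyIntegrable f)
    (hw : ∀ θ : 𝔼 N → ℝ, ContDiff ℝ (⊤ : ℕ∞) θ → HasCompactSupport θ →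
      ∫ x, u x * fracLap N α θ x = -∫ x, f x * θ x) (x₀ : 𝔼 N) :
    ∫⁻ x, ENNReal.ofReal (bumpConst N α * rieszKernel N α (x - x₀) * f x) ≤
      ENNReal.ofReal (2 * M * ∫ y, |smoothedDelta N α y|) := by
  have hae : ∀ᵐ x : 𝔼 N, x - x₀ ≠ 0 :=
    (measurePreserving_sub_right (volume : Measure (𝔼 N)) x₀).quasiMeasurePreserving.ae
      (ae_ne_zero_euclidean hN)
  have hm : Measurable (fun p : ℝ × 𝔼 N =>
      ENNReal.ofReal (p.1 ^ (α - N - 1) * radialBump N (p.1⁻¹ • (p.2 - x₀)) * f p.2)) := by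
    have h1 : Measurable fun p : ℝ × 𝔼 N => p.1 ^ (α - N - 1) := by fun_prop
    have h2 : Measurable fun p : ℝ × 𝔼 N => p.1⁻¹ • (p.2 - x₀) := by fun_prop
    exact ((h1.mul ((radialBump_contDiff N).continuous.measurable.comp h2)).mul
      (hf.comp measurable_snd)).ennreal_ofReal
  have h1 : ∫⁻ r in Set.Ioi (0 : ℝ), ∫⁻ x, ENNReal.ofReal
      (r ^ (α - N - 1) * radialBump N (r⁻¹ • (x - x₀)) * f x) ≤
      ENNReal.ofReal (2 * M * ∫ y, |smoothedDelta N α y|) := by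
    rw [← iUnion_Ioc_exhaust, setLIntegral_iUnion_of_directed _ monotone_Ioc_exhaust.directed_le]
    refine iSup_le fun n => lintegral_superposition_le hN hα1 hα2 hu hM hf0 hfl hw x₀
      (by positivity) ?_
    rw [div_le_iff₀ (by positivity)]
    have : (0 : ℝ) ≤ n := by positivity
    nlinarith
  rw [lintegral_lintegral_swap hm.aemeasurable] at h1
  refine le_trans (le_of_eq (lintegral_congr_ae ?_)) h1
  filter_upwards [hae] with x hx
  rw [← integral_superposition hx, ← integral_mul_const, ofReal_integral_eq_lintegral_ofReal]
  · exact (integrableOn_superposition hN hα2 hx).mul_const _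
  · refine (ae_restrict_iff' measurableSet_Ioi).2 (ae_of_all _ fun r hr => ?_)
    have hr' : (0 : ℝ) < r := hr
    exact mul_nonneg (mul_nonneg (by positivity) (radialBump_nonneg _)) (hf0 x)

lemma antitone_comp_max {φ : ℝ → ℝ≥0∞} (hφanti : AntitoneOn φ (Set.Ioi 0))
    (hφ0 : Tendsto φ (nhdsWithin 0 (Set.Ioi 0)) (nhds (φ 0))) :
    Antitone (fun t => φ (max t 0)) := by
  have h0 : ∀ t, 0 < t → φ t ≤ φ 0 := fun t ht => by
    refine ge_of_tendsto hφ0 ?_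
    filter_upwards [Ioo_mem_nhdsGT ht] with s hs
    exact hφanti hs.1 ht hs.2.le
  intro s t hst
  rcases le_or_gt t 0 with h | h
  · simp [max_eq_right h, max_eq_right (hst.trans h)]
  · rcases le_or_gt s 0 with h' | h'
    · simp only [max_eq_right h', max_eq_left h.le]; exact h0 t h
    · simp only [max_eq_left h'.le, max_eq_left h.le]; exact hφanti h' h hst

lemma potential_bounded_of_solution (hN : 3 ≤ N) (hα1 : 0 < α) (hα2 : α < 2)
    {ρ : 𝔼 N → ℝ} (hρm : Measurable ρ) (hρnn : ∀ x, 0 ≤ ρ x) {φ : ℝ → ℝ≥0∞}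
    (hφanti : AntitoneOn φ (Set.Ioi 0)) (hφpos : ∀ t : ℝ, 0 < t → 0 < φ t ∧ φ t < ⊤)
    (hφ0 : Tendsto φ (nhdsWithin 0 (Set.Ioi 0)) (nhds (φ 0))) {u : 𝔼 N → ℝ}
    (hu : NegEntireSol N α ρ φ u) :
    (⨆ x : 𝔼 N, ∫⁻ y, ENNReal.ofReal (ρ y * ‖x - y‖ ^ (-((N : ℝ) - α)))) < ⊤ := by
  obtain ⟨huc, ⟨M, hM⟩, hu0, hfin, hw⟩ := hu
  have hM0 : 0 ≤ M := (hu0 0).trans (hM 0)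
  have hanti := antitone_comp_max hφanti hφ0
  set F : 𝔼 N → ℝ≥0∞ := fun x => ENNReal.ofReal (ρ x) * φ (u x) with hF
  have hFm : Measurable F := by
    refine hρm.ennreal_ofReal.mul ?_
    have := hanti.measurable.comp huc.measurable
    have e : (fun t => φ (max t 0)) ∘ u = fun x => φ (u x) := by
      ext x; simp [max_eq_left (hu0 x)]
    rwa [e] at this
  have hFl : ∀ᵐ x, F x < ⊤ := by
    have h : ∀ n : ℕ, ∀ᵐ x, x ∈ Metric.closedBall (0 : 𝔼 N) n → F x < ⊤ := fun n =>
      (ae_restrict_iff' Metric.isClosed_closedBall.measurableSet).1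
        (ae_lt_top hFm (hfin _ (isCompact_closedBall _ _)))
    filter_upwards [ae_all_iff.2 h] with x hx
    obtain ⟨n, hn⟩ := exists_nat_ge ‖x‖
    exact hx n (by simpa using hn)
  have hfl : LocallyIntegrable (fun x => (F x).toReal) := by
    rw [locallyIntegrable_iff]
    exact fun K hK => integrable_toReal_of_lintegral_ne_top hFm.aemeasurable (hfin K hK)
  have key := riesz_potential_le hN hα1 hα2 huc.measurable (M := M)
    (fun x => by rw [abs_of_nonneg (hu0 x)]; exact hM x) (fun x => ENNReal.toReal_nonneg)
    hFm.ennreal_toReal hfl hw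
  have hb := bumpConst_pos (α := α) hN hα2
  have hφM := hφpos (M + 1) (by linarith)
  set c : ℝ := (φ (M + 1)).toReal with hc
  have hc0 : 0 < c := ENNReal.toReal_pos hφM.1.ne' hφM.2.ne
  have hge : ∀ᵐ x, c * ρ x ≤ (F x).toReal := by
    filter_upwards [hFl] with x hx
    have h1 : ENNReal.ofReal (ρ x) * φ (M + 1) ≤ F x := by
      refine mul_le_mul_right ?_ _
      have := hanti (a := u x) (b := M + 1) (by linarith [hM x])
      simpa [max_eq_left (hu0 x), max_eq_left (by linarith : (0 : ℝ) ≤ M + 1)] using this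
    have h2 := ENNReal.toReal_mono hx.ne h1
    rwa [ENNReal.toReal_mul, ENNReal.toReal_ofReal (hρnn x), mul_comm] at h2
  set D : ℝ := 2 * M * ∫ y, |smoothedDelta N α y|
  refine lt_of_le_of_lt (iSup_le fun x => ?_)
    (ENNReal.ofReal_lt_top (r := (bumpConst N α * c)⁻¹ * D))
  have e : ∀ᵐ y, ENNReal.ofReal (ρ y * ‖x - y‖ ^ (-((N : ℝ) - α))) ≤
      ENNReal.ofReal (bumpConst N α * c)⁻¹ *
        ENNReal.ofReal (bumpConst N α * rieszKernel N α (y - x) * (F y).toReal) := by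
    filter_upwards [hge] with y hy
    rw [← ENNReal.ofReal_mul (by positivity)]
    apply ENNReal.ofReal_le_ofReal
    have hk : ‖x - y‖ ^ (-((N : ℝ) - α)) = rieszKernel N α (y - x) := by
      rw [rieszKernel, norm_sub_rev]
    rw [hk]
    have hk0 := rieszKernel_nonneg (α := α) (y - x)
    calc ρ y * rieszKernel N α (y - x)
        = (bumpConst N α * c)⁻¹ * (bumpConst N α * rieszKernel N α (y - x) * (c * ρ y)) := by
          field_simp
      _ ≤ _ := by gcongr
  refine (lintegral_mono_ae e).trans ?_
  rw [lintegral_const_mul' _ _ ENNReal.ofReal_ne_top, ENNReal.ofReal_mul (by positivity)]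
  exact mul_le_mul_right (key x) _

end

/-- A Lipschitz dissipative map on a real Hilbert space has a fixed point. -/
lemma exists_fixedPoint_of_dissipative {H : Type*} [NormedAddCommGroup H] [InnerProductSpace ℝ H]
    [CompleteSpace H] {T : H → H} {K : ℝ} (hK : ∀ v w, ‖T v - T w‖ ≤ K * ‖v - w‖)
    (hT : ∀ v w, inner ℝ (T v - T w) (v - w) ≤ 0) : ∃ v, T v = v := by
  set e : ℝ := 1 / (1 + K ^ 2) with he
  have hK1 : 0 < 1 + K ^ 2 := by positivity
  have he0 : 0 < e := by positivity
  have he1 : e ≤ 1 := by rw [he, div_le_one hK1]; nlinarith [sq_nonneg K]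
  set q : ℝ := K ^ 2 / (1 + K ^ 2) with hq
  have hq0 : 0 ≤ q := by positivity
  have hq1 : q < 1 := by rw [hq, div_lt_one hK1]; linarith
  set S : H → H := fun v => (1 - e) • v + e • T v with hS
  have hdist : ∀ v w, ‖S v - S w‖ ≤ √q * ‖v - w‖ := by
    intro v w
    have e1 : S v - S w = (1 - e) • (v - w) + e • (T v - T w) := by
      simp only [hS, smul_sub]; abel
    have h2 : ‖S v - S w‖ ^ 2 ≤ q * ‖v - w‖ ^ 2 := by
      rw [e1, norm_add_sq_real, norm_smul, norm_smul, inner_smul_left, inner_smul_right,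
        real_inner_comm, Real.norm_of_nonneg he0.le, Real.norm_of_nonneg (by linarith : 0 ≤ 1 - e)]
      simp only [conj_trivial]
      have a1 := hT v w
      have a2 : ‖T v - T w‖ ^ 2 ≤ (K * ‖v - w‖) ^ 2 :=
        pow_le_pow_left₀ (norm_nonneg _) (hK v w) 2
      have a3 : 2 * ((1 - e) * (e * inner ℝ (T v - T w) (v - w))) ≤ 0 := by
        have : (1 - e) * e * inner ℝ (T v - T w) (v - w) ≤ 0 :=
          mul_nonpos_of_nonneg_of_nonpos (mul_nonneg (by linarith) he0.le) a1
        linarith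
      have a4 : (1 - e) ^ 2 + e ^ 2 * K ^ 2 = q := by
        rw [he, hq]; field_simp; ring
      have a5 := mul_le_mul_of_nonneg_left a2 (sq_nonneg e)
      calc _ ≤ (1 - e) ^ 2 * ‖v - w‖ ^ 2 + e ^ 2 * (K * ‖v - w‖) ^ 2 := by nlinarith
        _ = ((1 - e) ^ 2 + e ^ 2 * K ^ 2) * ‖v - w‖ ^ 2 := by ring
        _ = _ := by rw [a4]
    have := Real.sqrt_le_sqrt h2
    rwa [Real.sqrt_sq (norm_nonneg _), Real.sqrt_mul hq0, Real.sqrt_sq (norm_nonneg _)] at this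
  have hc : ContractingWith (Real.toNNReal √q) S := by
    refine ⟨?_, LipschitzWith.of_dist_le_mul fun v w => ?_⟩
    · rw [← NNReal.coe_lt_coe, Real.coe_toNNReal _ (Real.sqrt_nonneg _), NNReal.coe_one,
        Real.sqrt_lt' one_pos]
      simpa using hq1
    · rw [Real.coe_toNNReal _ (Real.sqrt_nonneg _), dist_eq_norm, dist_eq_norm]
      exact hdist v w
  obtain ⟨v, hv, -⟩ := hc.exists_fixedPoint 0 (edist_ne_top _ _)
  refine ⟨v, ?_⟩
  have h1 : (1 - e) • v + e • T v = v := hv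
  have h2 : e • (T v - v) = 0 := by
    rw [smul_sub, sub_eq_zero]
    have : e • T v = v - (1 - e) • v := by rw [eq_sub_iff_add_eq, add_comm]; exact h1
    rw [this, sub_smul, one_smul]; abel
  exact sub_eq_zero.1 ((smul_eq_zero.1 h2).resolve_left (ne_of_gt he0))

/-- Nonlinear integral equations with a kernel given by a feature map and an antitone
Lipschitz nonlinearity are solvable. -/
lemma exists_nonlinear_integral_solution {X H : Type*} [TopologicalSpace X]
    [SecondCountableTopology X] [MeasurableSpace X] [OpensMeasurableSpace X] {μ : Measure X}
    [NormedAddCommGroup H] [InnerProductSpace ℝ H] [CompleteSpace H] {ξ : X → H}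
    (hξ : Continuous ξ) {B : ℝ} (hB : ∀ x, ‖ξ x‖ ≤ B) {q : X → ℝ} (hq : Integrable q μ)
    (hq0 : ∀ x, 0 ≤ q x) {g : ℝ → ℝ} (hga : Antitone g) {L : ℝ}
    (hgL : ∀ s t, |g s - g t| ≤ L * |s - t|) {b : ℝ} (hgb : ∀ t, |g t| ≤ b) :
    ∃ w : X → ℝ, Continuous w ∧ ∀ x, w x = ∫ y, q y * g (w y) * inner ℝ (ξ x) (ξ y) ∂μ := by
  have hgc : Continuous g := by
    refine (LipschitzWith.of_dist_le_mul (K := Real.toNNReal (max L 0)) fun s t => ?_).continuous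
    rw [Real.coe_toNNReal _ (le_max_right _ _), Real.dist_eq, Real.dist_eq]
    exact (hgL s t).trans (mul_le_mul_of_nonneg_right (le_max_left _ _) (abs_nonneg _))
  have hL0 : 0 ≤ L := by
    have := (abs_nonneg _).trans (hgL 1 0)
    simpa using this
  have hcξ : ∀ v : H, Continuous fun y => g (inner ℝ (ξ y) v) := fun v =>
    hgc.comp (hξ.inner continuous_const)
  have hb0 : 0 ≤ b := (abs_nonneg _).trans (hgb 0)
  have hi : ∀ v : H, Integrable (fun y => (q y * g (inner ℝ (ξ y) v)) • ξ y) μ := fun v => by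
    refine (hq.mul_const (b * B)).mono' ((hq.1.mul (hcξ v).aestronglyMeasurable).smul
      hξ.aestronglyMeasurable) (ae_of_all _ fun y => ?_)
    rw [norm_smul, norm_mul, Real.norm_of_nonneg (hq0 y), mul_assoc]
    exact mul_le_mul_of_nonneg_left (mul_le_mul (hgb _) (hB y) (norm_nonneg _) hb0) (hq0 y)
  set T : H → H := fun v => ∫ y, (q y * g (inner ℝ (ξ y) v)) • ξ y ∂μ with hTdef
  have hTinner : ∀ v u, inner ℝ u (T v) = ∫ y, q y * g (inner ℝ (ξ y) v) * inner ℝ u (ξ y) ∂μ :=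
    fun v u => by
      rw [hTdef, ← integral_inner (hi v)]
      simp only [inner_smul_right]
  have hsub : ∀ v w, T v - T w = ∫ y, (q y * (g (inner ℝ (ξ y) v) - g (inner ℝ (ξ y) w))) • ξ y ∂μ :=
    fun v w => by
      rw [hTdef, ← integral_sub (hi v) (hi w)]
      congr 1; ext y; rw [← sub_smul, mul_sub]
  have hisub : ∀ v w, Integrable
      (fun y => (q y * (g (inner ℝ (ξ y) v) - g (inner ℝ (ξ y) w))) • ξ y) μ := fun v w =>
    ((hi v).sub (hi w)).congr (ae_of_all _ fun y => by
      simp only [Pi.sub_apply]; rw [← sub_smul, mul_sub])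
  obtain ⟨v, hv⟩ := exists_fixedPoint_of_dissipative (T := T) (K := (∫ y, q y ∂μ) * (L * B * B))
    (fun v w => by
      rw [hsub, ← integral_mul_const, ← integral_mul_const]
      refine norm_integral_le_of_norm_le ((hq.mul_const _).mul_const _) (ae_of_all _ fun y => ?_)
      have hB0 : 0 ≤ B := (norm_nonneg _).trans (hB y)
      rw [norm_smul, norm_mul, Real.norm_of_nonneg (hq0 y), mul_assoc, mul_assoc]
      refine mul_le_mul_of_nonneg_left ?_ (hq0 y)
      calc ‖g (inner ℝ (ξ y) v) - g (inner ℝ (ξ y) w)‖ * ‖ξ y‖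
          ≤ (L * (B * ‖v - w‖)) * B := by
            refine mul_le_mul ((hgL _ _).trans (mul_le_mul_of_nonneg_left ?_ hL0)) (hB y)
              (norm_nonneg _) (by positivity)
            rw [← inner_sub_right]
            exact (abs_real_inner_le_norm _ _).trans
              (mul_le_mul_of_nonneg_right (hB y) (norm_nonneg _))
        _ = _ := by ring)
    (fun v w => by
      rw [hsub, real_inner_comm, ← integral_inner (hisub v w)]
      refine integral_nonpos fun y => ?_
      simp only [inner_smul_right, Pi.zero_apply]
      rw [mul_assoc]
      refine mul_nonpos_of_nonneg_of_nonpos (hq0 y) ?_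
      rw [real_inner_comm (ξ y) (v - w), inner_sub_right]
      rcases le_total (inner ℝ (ξ y) v) (inner ℝ (ξ y) w) with h | h
      · exact mul_nonpos_of_nonneg_of_nonpos (sub_nonneg.2 (hga h)) (sub_nonpos.2 h)
      · exact mul_nonpos_of_nonpos_of_nonneg (sub_nonpos.2 (hga h)) (sub_nonneg.2 h))
  refine ⟨fun x => inner ℝ (ξ x) v, hξ.inner continuous_const, fun x => ?_⟩
  simp only
  conv_lhs => rw [← hv]
  exact hTinner v (ξ x)

section
variable {N : ℕ} {α : ℝ}

/-- The regularised kernel `(‖x‖² + ε)^{-s}`. -/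
def regKernel (N : ℕ) (s ε : ℝ) (x : 𝔼 N) : ℝ := (‖x‖ ^ 2 + ε) ^ (-s)

/-- Gaussian features whose inner products are multiples of `regKernel`. -/
def gaussianFeature (N : ℕ) (s ε : ℝ) (x : 𝔼 N) (p : ℝ × 𝔼 N) : ℝ :=
  p.1 ^ ((s - 1 + (N : ℝ) / 2) / 2) * (rexp (-(p.1 * ε / 2)) * rexp (-(2 * p.1 * ‖x - p.2‖ ^ 2)))

lemma measurable_gaussianFeature (s ε : ℝ) (x : 𝔼 N) : Measurable (gaussianFeature N s ε x) := by
  unfold gaussianFeature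
  fun_prop

lemma gaussianFeature_mul (s ε : ℝ) (x y : 𝔼 N) {t : ℝ} (ht : 0 < t) (z : 𝔼 N) :
    gaussianFeature N s ε x (t, z) * gaussianFeature N s ε y (t, z) =
      t ^ (s - 1 + (N : ℝ) / 2) * rexp (-((ε + ‖x - y‖ ^ 2) * t)) *
        rexp (-(4 * t) * ‖z - (2⁻¹ : ℝ) • (x + y)‖ ^ 2) := by
  have hp : ‖x - z‖ ^ 2 + ‖y - z‖ ^ 2 =
      2 * ‖z - (2⁻¹ : ℝ) • (x + y)‖ ^ 2 + ‖x - y‖ ^ 2 / 2 := by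
    have h := parallelogram_law_with_norm ℝ (x - z) (y - z)
    have e1 : x - z - (y - z) = x - y := by abel
    have e2 : x - z + (y - z) = (-2 : ℝ) • (z - (2⁻¹ : ℝ) • (x + y)) := by
      rw [smul_sub, smul_smul]; norm_num
      rw [two_smul]; abel
    rw [e1, e2, norm_smul, show ‖(-2 : ℝ)‖ = 2 by norm_num, mul_pow] at h
    linarith
  unfold gaussianFeature
  have e3 : t ^ (s - 1 + (N : ℝ) / 2) = t ^ ((s - 1 + (N : ℝ) / 2) / 2) *
      t ^ ((s - 1 + (N : ℝ) / 2) / 2) := by rw [← Real.rpow_add ht]; congr 1; ring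
  have e4 : rexp (-(t * ε / 2)) * rexp (-(2 * t * ‖x - z‖ ^ 2)) *
      (rexp (-(t * ε / 2)) * rexp (-(2 * t * ‖y - z‖ ^ 2))) =
      rexp (-((ε + ‖x - y‖ ^ 2) * t)) * rexp (-(4 * t) * ‖z - (2⁻¹ : ℝ) • (x + y)‖ ^ 2) := by
    simp only [← Real.exp_add]
    congr 1
    linear_combination (-2 * t) * hp
  rw [e3]
  linear_combination (t ^ ((s - 1 + (N : ℝ) / 2) / 2)) ^ 2 * e4

lemma integral_gaussianFeature_mul (s ε : ℝ) (x y : 𝔼 N) {t : ℝ} (ht : 0 < t) :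
    ∫ z, gaussianFeature N s ε x (t, z) * gaussianFeature N s ε y (t, z) =
      (π / 4) ^ ((N : ℝ) / 2) * (t ^ (s - 1) * rexp (-((ε + ‖x - y‖ ^ 2) * t))) := by
  simp only [gaussianFeature_mul s ε x y ht]
  rw [integral_const_mul, integral_sub_right_eq_self
    (fun z : 𝔼 N => rexp (-(4 * t) * ‖z‖ ^ 2)), GaussianFourier.integral_rexp_neg_mul_sq_norm
    (by positivity), finrank_euclideanSpace_fin, show π / (4 * t) = (π / 4) * t⁻¹ by field_simp,
    Real.mul_rpow (by positivity) (by positivity), Real.inv_rpow ht.le, Real.rpow_add ht]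
  have := Real.rpow_pos_of_pos ht ((N : ℝ) / 2)
  field_simp

lemma integrable_gaussianFeature_mul {s ε : ℝ} (hs : 0 < s) (hε : 0 < ε) (x y : 𝔼 N) :
    Integrable (fun p => gaussianFeature N s ε x p * gaussianFeature N s ε y p)
      ((volume.restrict (Set.Ioi (0 : ℝ))).prod volume) := by
  have hm : Measurable fun p => gaussianFeature N s ε x p * gaussianFeature N s ε y p :=
    (measurable_gaussianFeature s ε x).mul (measurable_gaussianFeature s ε y)
  rw [integrable_prod_iff hm.aestronglyMeasurable]
  constructor
  · filter_upwards [ae_restrict_mem measurableSet_Ioi] with t ht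
    refine not_imp_comm.1 integral_undef ?_
    rw [integral_gaussianFeature_mul s ε x y ht]
    have := Real.rpow_pos_of_pos ht (s - 1)
    positivity
  · have h : Integrable (fun t : ℝ => (π / 4) ^ ((N : ℝ) / 2) *
        (t ^ (s - 1) * rexp (-((ε + ‖x - y‖ ^ 2) * t)))) (volume.restrict (Set.Ioi (0 : ℝ))) := by
      refine Integrable.const_mul (not_imp_comm.1 integral_undef ?_) _
      rw [Real.integral_rpow_mul_exp_neg_mul_Ioi hs (by positivity)]
      have := Real.Gamma_pos_of_pos hs
      positivity
    refine h.congr ?_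
    filter_upwards [ae_restrict_mem measurableSet_Ioi] with t ht
    rw [← integral_gaussianFeature_mul s ε x y ht]
    refine integral_congr_ae (ae_of_all _ fun z => ?_)
    have ht' : (0 : ℝ) < t := ht
    refine (Real.norm_of_nonneg ?_).symm
    unfold gaussianFeature
    positivity

lemma integral_gaussianFeature_prod {s ε : ℝ} (hs : 0 < s) (hε : 0 < ε) (x y : 𝔼 N) :
    ∫ p, gaussianFeature N s ε x p * gaussianFeature N s ε y p
      ∂((volume.restrict (Set.Ioi (0 : ℝ))).prod volume) =
      (π / 4) ^ ((N : ℝ) / 2) * Real.Gamma s * regKernel N s ε (x - y) := by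
  rw [integral_prod _ (integrable_gaussianFeature_mul hs hε x y)]
  rw [setIntegral_congr_fun measurableSet_Ioi
    (fun t ht => integral_gaussianFeature_mul s ε x y ht), integral_const_mul,
    Real.integral_rpow_mul_exp_neg_mul_Ioi hs (by positivity)]
  rw [regKernel, one_div, Real.inv_rpow (by positivity), ← Real.rpow_neg (by positivity),
    add_comm ε]
  ring

lemma continuous_regKernel {s ε : ℝ} (hε : 0 < ε) : Continuous (regKernel N s ε) := by
  unfold regKernel
  refine Continuous.rpow_const (by fun_prop) fun x => Or.inl (by positivity)

lemma exists_feature_map {s ε : ℝ} (hs : 0 < s) (hε : 0 < ε) :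
    ∃ ξ : 𝔼 N → Lp ℝ 2 ((volume.restrict (Set.Ioi (0 : ℝ))).prod (volume : Measure (𝔼 N))),
      Continuous ξ ∧ (∀ x y, inner ℝ (ξ x) (ξ y) = regKernel N s ε (x - y)) := by
  have hm : ∀ x : 𝔼 N, MemLp (gaussianFeature N s ε x) 2
      ((volume.restrict (Set.Ioi (0 : ℝ))).prod volume) := fun x => by
    rw [memLp_two_iff_integrable_sq (measurable_gaussianFeature s ε x).aestronglyMeasurable]
    simpa only [sq] using integrable_gaussianFeature_mul hs hε x x
  set A : ℝ := (π / 4) ^ ((N : ℝ) / 2) * Real.Gamma s with hA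
  have hA0 : 0 < A := by
    have := Real.Gamma_pos_of_pos hs
    positivity
  let η : 𝔼 N → Lp ℝ 2 ((volume.restrict (Set.Ioi (0 : ℝ))).prod (volume : Measure (𝔼 N))) :=
    fun x => (hm x).toLp _
  have hin : ∀ x y : 𝔼 N, inner ℝ ((√A)⁻¹ • η x) ((√A)⁻¹ • η y) =
      regKernel N s ε (x - y) := fun x y => by
    rw [inner_smul_left, inner_smul_right, L2.inner_def]
    have e : ∫ a, inner ℝ (η x a) (η y a)
        ∂((volume.restrict (Set.Ioi (0 : ℝ))).prod volume) = A * regKernel N s ε (x - y) := by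
      rw [← integral_gaussianFeature_prod hs hε x y]
      refine integral_congr_ae ?_
      filter_upwards [(hm x).coeFn_toLp, (hm y).coeFn_toLp] with a h1 h2
      change (η x : ℝ × 𝔼 N → ℝ) a = _ at h1
      change (η y : ℝ × 𝔼 N → ℝ) a = _ at h2
      rw [h1, h2, Real.inner_apply]
    rw [e]
    simp only [conj_trivial]
    have := Real.mul_self_sqrt hA0.le
    have h2 : √A ≠ 0 := (Real.sqrt_pos.2 hA0).ne'
    field_simp
    rw [sq, this]
  refine ⟨fun x => (√A)⁻¹ • η x, ?_, hin⟩
  rw [continuous_iff_continuousAt]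
  intro x₀
  rw [ContinuousAt, tendsto_iff_norm_sub_tendsto_zero]
  have h1 : ∀ x, ‖(√A)⁻¹ • η x - (√A)⁻¹ • η x₀‖ =
      √(regKernel N s ε 0 - 2 * regKernel N s ε (x - x₀) + regKernel N s ε 0) := fun x => by
    rw [← Real.sqrt_sq (norm_nonneg _), norm_sub_sq_real, ← real_inner_self_eq_norm_sq,
      ← real_inner_self_eq_norm_sq, hin, hin, hin, sub_self, sub_self]
  simp only [h1]
  have h2 : Continuous fun x : 𝔼 N =>
      √(regKernel N s ε 0 - 2 * regKernel N s ε (x - x₀) + regKernel N s ε 0) := by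
    have h3 := continuous_regKernel (N := N) (s := s) hε
    fun_prop
  have := h2.tendsto x₀
  rw [sub_self] at this
  convert this using 2
  rw [show regKernel N s ε 0 - 2 * regKernel N s ε 0 + regKernel N s ε 0 = (0 : ℝ) by ring,
    Real.sqrt_zero]

end

section
variable {N : ℕ} {α : ℝ}

lemma rpow_neg_shift_sub_le {s ε a b : ℝ} (hs : 0 < s) (hε : 0 ≤ ε) (ha : 0 < a) (hab : a ≤ b) :
    (a + ε) ^ (-s) - (b + ε) ^ (-s) ≤ a ^ (-s) - b ^ (-s) := by
  have hd : ∀ t ∈ Set.Ioi (0 : ℝ), HasDerivAt (fun t : ℝ => t ^ (-s) - (t + ε) ^ (-s))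
      (-s * t ^ (-s - 1) - -s * (t + ε) ^ (-s - 1)) t := fun t ht => by
    have ht' : (0 : ℝ) < t := ht
    have h2 := ((hasDerivAt_id t).add_const ε).rpow_const (p := -s)
      (Or.inl (by simp only [id]; positivity))
    refine (Real.hasDerivAt_rpow_const (Or.inl ht'.ne')).sub (h2.congr_deriv ?_)
    simp
  have hanti : AntitoneOn (fun t : ℝ => t ^ (-s) - (t + ε) ^ (-s)) (Set.Ioi 0) := by
    refine antitoneOn_of_deriv_nonpos (convex_Ioi 0)
      (fun t ht => (hd t ht).continuousAt.continuousWithinAt) ?_ ?_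
    · rw [interior_Ioi]
      exact fun t ht => (hd t ht).differentiableAt.differentiableWithinAt
    · rw [interior_Ioi]
      intro t ht
      rw [(hd t ht).deriv]
      have := Real.rpow_le_rpow_of_nonpos (z := -s - 1) (x := t) (y := t + ε) ht (by linarith)
        (by linarith)
      nlinarith
  have := hanti ha (ha.trans_le hab : (0 : ℝ) < b) hab
  simp only at this
  linarith

lemma rieszKernel_eq_rpow_sq (x : 𝔼 N) :
    rieszKernel N α x = (‖x‖ ^ 2) ^ (-(((N : ℝ) - α) / 2)) := by
  rw [rieszKernel, ← Real.rpow_natCast, ← Real.rpow_mul (norm_nonneg _)]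
  congr 1; push_cast; ring

lemma regKernel_nonneg {s ε : ℝ} (hε : 0 ≤ ε) (x : 𝔼 N) : 0 ≤ regKernel N s ε x := by
  unfold regKernel; positivity

lemma regKernel_le_rieszKernel (hN : 3 ≤ N) (hα2 : α < 2) {ε : ℝ} (hε : 0 ≤ ε) {x : 𝔼 N}
    (hx : x ≠ 0) : regKernel N (((N : ℝ) - α) / 2) ε x ≤ rieszKernel N α x := by
  have hN' : (3 : ℝ) ≤ N := by exact_mod_cast hN
  have := norm_pos_iff.2 hx
  rw [rieszKernel_eq_rpow_sq, regKernel]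
  exact Real.rpow_le_rpow_of_nonpos (by positivity) (by linarith) (by linarith)

lemma abs_regKernel_sub_le (hN : 3 ≤ N) (hα2 : α < 2) {ε : ℝ} (hε : 0 ≤ ε) {x y : 𝔼 N}
    (hx : x ≠ 0) (hy : y ≠ 0) :
    |regKernel N (((N : ℝ) - α) / 2) ε x - regKernel N (((N : ℝ) - α) / 2) ε y| ≤
      |rieszKernel N α x - rieszKernel N α y| := by
  have hN' : (3 : ℝ) ≤ N := by exact_mod_cast hN
  wlog h : ‖x‖ ≤ ‖y‖ generalizing x y
  · rw [abs_sub_comm, abs_sub_comm (rieszKernel N α x)]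
    exact this hy hx (not_le.1 h).le
  have hx0 := norm_pos_iff.2 hx
  have hsq : ‖x‖ ^ 2 ≤ ‖y‖ ^ 2 := pow_le_pow_left₀ hx0.le h 2
  rw [rieszKernel_eq_rpow_sq, rieszKernel_eq_rpow_sq, regKernel, regKernel, abs_of_nonneg
    (sub_nonneg.2 (Real.rpow_le_rpow_of_nonpos (by positivity) (by linarith) (by linarith)))]
  exact (rpow_neg_shift_sub_le (by linarith) hε (by positivity) hsq).trans (le_abs_self _)

/-- Sliding averages of a bounded antitone function are antitone and Lipschitz. -/
lemma exists_lipschitz_antitone_between {Φ : ℝ → ℝ} (hc : Continuous Φ) (ha : Antitone Φ) {b : ℝ}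
    (h0 : ∀ t, 0 ≤ Φ t) (hb : ∀ t, Φ t ≤ b) {δ : ℝ} (hδ : 0 < δ) :
    ∃ g : ℝ → ℝ, Antitone g ∧ (∃ L, ∀ s t, |g s - g t| ≤ L * |s - t|) ∧
      ∀ t, Φ (t + δ) ≤ g t ∧ g t ≤ Φ t := by
  have hi : ∀ a c, IntervalIntegrable Φ volume a c := fun a c => hc.intervalIntegrable _ _
  have hshift : ∀ t, ∫ x in t..t + δ, Φ x = ∫ x in (0 : ℝ)..δ, Φ (t + x) := fun t => by
    rw [intervalIntegral.integral_comp_add_left, add_zero]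
  have hi2 : ∀ t, IntervalIntegrable (fun x => Φ (t + x)) volume 0 δ := fun t =>
    (hc.comp (continuous_const.add continuous_id)).intervalIntegrable _ _
  refine ⟨fun t => δ⁻¹ * ∫ x in t..t + δ, Φ x, fun s t hst => ?_, ⟨δ⁻¹ * (2 * b), fun s t => ?_⟩,
    fun t => ⟨?_, ?_⟩⟩
  · simp only [hshift]
    refine mul_le_mul_of_nonneg_left ?_ (by positivity)
    exact intervalIntegral.integral_mono_on hδ.le (hi2 t) (hi2 s) fun x _ => ha (by linarith)
  · have e : (∫ x in s..s + δ, Φ x) - ∫ x in t..t + δ, Φ x =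
        (∫ x in t + δ..s + δ, Φ x) - ∫ x in t..s, Φ x := by
      have h1 := intervalIntegral.integral_add_adjacent_intervals (hi t s) (hi s (s + δ))
      have h2 := intervalIntegral.integral_add_adjacent_intervals (hi t (t + δ)) (hi (t + δ) (s + δ))
      linarith
    have hn : ∀ a c, |∫ x in a..c, Φ x| ≤ b * |c - a| := fun a c => by
      rw [← Real.norm_eq_abs]
      refine intervalIntegral.norm_integral_le_of_norm_le_const fun x _ => ?_
      rw [Real.norm_of_nonneg (h0 x)]
      exact hb x
    simp only
    rw [← mul_sub, e, abs_mul, abs_of_pos (inv_pos.2 hδ), mul_assoc]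
    refine mul_le_mul_of_nonneg_left ?_ (by positivity)
    have h3 := hn (t + δ) (s + δ)
    have h4 := hn t s
    rw [show s + δ - (t + δ) = s - t by ring] at h3
    refine (abs_sub _ _).trans ?_
    linarith
  · simp only [hshift]
    have h := intervalIntegral.integral_mono_on hδ.le
      (intervalIntegrable_const (μ := volume) (c := Φ (t + δ))) (hi2 t)
      fun x hx => ha (by linarith [hx.2])
    rw [intervalIntegral.integral_const, smul_eq_mul, sub_zero] at h
    rw [← div_eq_inv_mul, le_div_iff₀ hδ]
    linarith
  · simp only [hshift]
    have h := intervalIntegral.integral_mono_on hδ.le (hi2 t)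
      (intervalIntegrable_const (μ := volume) (c := Φ t))
      fun x hx => ha (by linarith [hx.1])
    rw [intervalIntegral.integral_const, smul_eq_mul, sub_zero] at h
    rw [← div_eq_inv_mul, div_le_iff₀ hδ]
    linarith

lemma exists_approximate_solution (hN : 3 ≤ N) (hα2 : α < 2)
    {ρ : 𝔼 N → ℝ} (hρm : Measurable ρ) (hρnn : ∀ x, 0 ≤ ρ x)
    (hρlb : ∀ R : ℝ, ∃ M : ℝ, ∀ x : 𝔼 N, ‖x‖ ≤ R → ρ x ≤ M) {Φ : ℝ → ℝ} (hc : Continuous Φ)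
    (ha : Antitone Φ) {b : ℝ} (h0 : ∀ t, 0 ≤ Φ t) (hb : ∀ t, Φ t ≤ b) {δ : ℝ} (hδ : 0 < δ)
    (R : ℝ) :
    ∃ (w : 𝔼 N → ℝ) (g : ℝ → ℝ), Continuous w ∧ Continuous g ∧
      (∀ t, Φ (t + δ) ≤ g t ∧ g t ≤ Φ t) ∧
      ∀ x, w x = ∫ y, (Metric.closedBall 0 R).indicator ρ y * g (w y) *
        regKernel N (((N : ℝ) - α) / 2) δ (x - y) := by
  have hN' : (3 : ℝ) ≤ N := by exact_mod_cast hN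
  obtain ⟨g, hga, ⟨L, hL⟩, hg⟩ := exists_lipschitz_antitone_between hc ha h0 hb hδ
  obtain ⟨ξ, hξ, hin⟩ := exists_feature_map (N := N) (s := ((N : ℝ) - α) / 2) (by linarith) hδ
  obtain ⟨M, hM⟩ := hρlb R
  have hq : Integrable ((Metric.closedBall (0 : 𝔼 N) R).indicator ρ) := by
    rw [integrable_indicator_iff measurableSet_closedBall]
    refine Measure.integrableOn_of_bounded (M := M) measure_closedBall_lt_top.ne
      hρm.aestronglyMeasurable ?_
    filter_upwards [ae_restrict_mem measurableSet_closedBall] with x hx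
    rw [Real.norm_of_nonneg (hρnn x)]
    exact hM x (mem_closedBall_zero_iff.1 hx)
  have hB : ∀ x, ‖ξ x‖ ≤ √(regKernel N (((N : ℝ) - α) / 2) δ 0) := fun x => by
    rw [← Real.sqrt_sq (norm_nonneg (ξ x)), ← real_inner_self_eq_norm_sq, hin, sub_self]
  have hgb : ∀ t, |g t| ≤ b := fun t => by
    rw [abs_of_nonneg ((h0 _).trans (hg t).1)]
    exact (hg t).2.trans (hb t)
  obtain ⟨w, hw, hwe⟩ := exists_nonlinear_integral_solution hξ hB hq
    (Set.indicator_nonneg fun x _ => hρnn x) hga hL hgb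
  have hgc : Continuous g := by
    refine (LipschitzWith.of_dist_le_mul (K := Real.toNNReal (max L 0)) fun s t => ?_).continuous
    rw [Real.coe_toNNReal _ (le_max_right _ _), Real.dist_eq, Real.dist_eq]
    exact (hL s t).trans (mul_le_mul_of_nonneg_right (le_max_left _ _) (abs_nonneg _))
  refine ⟨w, g, hw, hgc, hg, fun x => ?_⟩
  rw [hwe x]
  simp only [hin]

end

section
variable {N : ℕ} {α : ℝ}

lemma continuousAt_rieszKernel {x : 𝔼 N} (hx : x ≠ 0) : ContinuousAt (rieszKernel N α) x :=
  continuous_norm.continuousAt.rpow_const (Or.inl (norm_ne_zero_iff.2 hx))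

lemma ae_sub_ne_zero (hN : 3 ≤ N) (x : 𝔼 N) : ∀ᵐ y : 𝔼 N, x - y ≠ 0 := by
  have h := (Measure.measurePreserving_sub_left volume x).quasiMeasurePreserving.ae (ae_ne_zero_euclidean hN)
  exact h

lemma rieszKernel_sub_tendsto {x y : 𝔼 N} (h : x - y ≠ 0) :
    Tendsto (fun x' => rieszKernel N α (x' - y)) (𝓝 x) (𝓝 (rieszKernel N α (x - y))) :=
  (continuousAt_rieszKernel h).tendsto.comp
    ((continuous_id.sub continuous_const).tendsto x)

lemma integrable_rieszKernel_sub_mul (hN : 3 ≤ N) (hα1 : 0 < α) {χ : 𝔼 N → ℝ} (hχ : Continuous χ)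
    (hc : HasCompactSupport χ) (x : 𝔼 N) : Integrable fun y => rieszKernel N α (x - y) * χ y := by
  have := (hc.convolutionExists_left (ContinuousLinearMap.mul ℝ ℝ) hχ
    (locallyIntegrable_rieszKernel (α := α) hN hα1)) x
  refine this.integrable.congr (ae_of_all _ fun y => ?_)
  simp [mul_comm]

lemma tendsto_integral_abs_rieszKernel_sub_mul (hN : 3 ≤ N) (hα1 : 0 < α) {χ : 𝔼 N → ℝ}
    (hχ : Continuous χ) (hc : HasCompactSupport χ) (h0 : ∀ y, 0 ≤ χ y) (x : 𝔼 N) :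
    Tendsto (fun x' => ∫ y, |rieszKernel N α (x - y) - rieszKernel N α (x' - y)| * χ y)
      (𝓝 x) (𝓝 0) := by
  set k := rieszKernel N α with hk
  have hki := integrable_rieszKernel_sub_mul (α := α) hN hα1 hχ hc
  have hkm : ∀ x, Measurable fun y => k (x - y) := fun x =>
    (measurable_rieszKernel).comp (measurable_const.sub measurable_id)
  have hF : Continuous fun x => ∫ y, k (x - y) * χ y := by
    have := hc.continuous_convolution_left (ContinuousLinearMap.mul ℝ ℝ) hχ
      (locallyIntegrable_rieszKernel (α := α) hN hα1)
    refine this.congr fun x => ?_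
    simp only [convolution_def, ContinuousLinearMap.mul_apply', mul_comm, hk]
  have hmi : ∀ x', Integrable fun y => min (k (x - y)) (k (x' - y)) * χ y := fun x' => by
    refine (hki x).mono' (((hkm x).min (hkm x')).mul hχ.measurable).aestronglyMeasurable
      (ae_of_all _ fun y => ?_)
    rw [norm_mul, Real.norm_of_nonneg (h0 y), Real.norm_of_nonneg
      (le_min (rieszKernel_nonneg _) (rieszKernel_nonneg _))]
    exact mul_le_mul_of_nonneg_right (min_le_left _ _) (h0 y)
  have hG : Tendsto (fun x' => ∫ y, min (k (x - y)) (k (x' - y)) * χ y) (𝓝 x)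
      (𝓝 (∫ y, k (x - y) * χ y)) := by
    refine tendsto_integral_filter_of_dominated_convergence (fun y => k (x - y) * χ y)
      (Eventually.of_forall fun x' => (hmi x').1)
      (Eventually.of_forall fun x' => ae_of_all _ fun y => ?_) (hki x) ?_
    · rw [norm_mul, Real.norm_of_nonneg (h0 y), Real.norm_of_nonneg
        (le_min (rieszKernel_nonneg _) (rieszKernel_nonneg _))]
      exact mul_le_mul_of_nonneg_right (min_le_left _ _) (h0 y)
    · filter_upwards [ae_sub_ne_zero hN x] with y hy
      have h1 := (tendsto_const_nhds (x := k (x - y))).min (rieszKernel_sub_tendsto (α := α) hy)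
      rw [← hk, min_self] at h1
      exact h1.mul_const _
  have e : ∀ x', ∫ y, |k (x - y) - k (x' - y)| * χ y =
      ((∫ y, k (x - y) * χ y) + ∫ y, k (x' - y) * χ y) -
        2 * ∫ y, min (k (x - y)) (k (x' - y)) * χ y := fun x' => by
    rw [← integral_const_mul, ← integral_add (hki x) (hki x'), ← integral_sub
      (f := fun y => k (x - y) * χ y + k (x' - y) * χ y) ((hki x).add (hki x'))
      ((hmi x').const_mul 2)]
    refine integral_congr_ae (ae_of_all _ fun y => ?_)
    simp only
    rcases le_total (k (x - y)) (k (x' - y)) with h | h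
    · rw [abs_of_nonpos (sub_nonpos.2 h), min_eq_left h]; ring
    · rw [abs_of_nonneg (sub_nonneg.2 h), min_eq_right h]; ring
  simp only [e]
  have := (tendsto_const_nhds (x := ∫ y, k (x - y) * χ y)).add (hF.tendsto x) |>.sub
    (hG.const_mul 2)
  convert this using 2
  ring

lemma rieszKernel_le_of_near (hN : 3 ≤ N) (hα2 : α < 2) {x y : 𝔼 N} (hx : x ≠ 0)
    (h : ‖x‖ ≤ 2 * ‖y‖) : rieszKernel N α y ≤ 2 ^ ((N : ℝ) - α) * rieszKernel N α x := by
  have hN' : (3 : ℝ) ≤ N := by exact_mod_cast hN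
  have hx0 := norm_pos_iff.2 hx
  have h1 : ‖y‖ ^ (-((N : ℝ) - α)) ≤ (‖x‖ / 2) ^ (-((N : ℝ) - α)) :=
    Real.rpow_le_rpow_of_nonpos (by positivity) (by linarith) (by linarith)
  refine h1.trans_eq ?_
  rw [Real.div_rpow hx0.le (by norm_num), Real.rpow_neg (by norm_num : (0 : ℝ) ≤ 2), rieszKernel]
  field_simp

lemma tendsto_integral_abs_rieszKernel_sub (hN : 3 ≤ N) (hα1 : 0 < α) (hα2 : α < 2)
    {ρ : 𝔼 N → ℝ} (hρm : Measurable ρ) (hρnn : ∀ x, 0 ≤ ρ x)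
    (hρlb : ∀ R : ℝ, ∃ M : ℝ, ∀ x : 𝔼 N, ‖x‖ ≤ R → ρ x ≤ M)
    (hi : ∀ x, Integrable fun y => rieszKernel N α (x - y) * ρ y) (x : 𝔼 N) :
    Tendsto (fun x' => ∫ y, |rieszKernel N α (x - y) - rieszKernel N α (x' - y)| * ρ y)
      (𝓝 x) (𝓝 0) := by
  set k := rieszKernel N α with hk
  have hkm : ∀ x, Measurable fun y => k (x - y) := fun x =>
    (measurable_rieszKernel).comp (measurable_const.sub measurable_id)
  let χ : ContDiffBump x := ⟨1, 2, one_pos, one_lt_two⟩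
  have hχc : Continuous χ := χ.continuous
  obtain ⟨M, hM⟩ := hρlb (‖x‖ + 2)
  have hM' : ∀ y, χ y * ρ y ≤ M * χ y := fun y => by
    rcases lt_or_ge (dist y x) 2 with h | h
    · rw [mul_comm]
      refine mul_le_mul_of_nonneg_right (hM y ?_) χ.nonneg
      rw [dist_eq_norm] at h
      linarith [norm_sub_norm_le y x]
    · rw [χ.zero_of_le_dist h]; simp
  have hd0 : ∀ x' y, 0 ≤ |k (x - y) - k (x' - y)| := fun _ _ => abs_nonneg _
  have hdm : ∀ x', Measurable fun y => |k (x - y) - k (x' - y)| := fun x' =>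
    ((hkm x).sub (hkm x')).abs
  have hdi : ∀ x', Integrable fun y => |k (x - y) - k (x' - y)| * ρ y := fun x' => by
    refine ((hi x).sub (hi x')).norm.congr (ae_of_all _ fun y => ?_)
    simp only [Pi.sub_apply]
    rw [← sub_mul, norm_mul, Real.norm_eq_abs, Real.norm_of_nonneg (hρnn y)]
  have hfar : Tendsto (fun x' => ∫ y, |k (x - y) - k (x' - y)| * ((1 - χ y) * ρ y))
      (𝓝 x) (𝓝 0) := by
    have : Tendsto (fun x' => ∫ y, |k (x - y) - k (x' - y)| * ((1 - χ y) * ρ y))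
      (𝓝 x) (𝓝 (∫ _y : 𝔼 N, (0 : ℝ))) := by
      refine tendsto_integral_filter_of_dominated_convergence
        (fun y => (1 + 2 ^ ((N : ℝ) - α)) * (k (x - y) * ρ y))
        (Eventually.of_forall fun x' => ((hdm x').mul ((measurable_const.sub
          hχc.measurable).mul hρm)).aestronglyMeasurable) ?_ ((hi x).const_mul _) ?_
      · filter_upwards [Metric.ball_mem_nhds x (by norm_num : (0 : ℝ) < 1 / 2)] with x' hx'
        refine ae_of_all _ fun y => ?_
        have h1 : 0 ≤ 1 - χ y := sub_nonneg.2 χ.le_one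
        rw [norm_mul, norm_mul, Real.norm_of_nonneg (hρnn y), Real.norm_of_nonneg h1, norm_abs_eq_norm,
          Real.norm_eq_abs]
        rcases lt_or_ge (dist y x) 1 with h | h
        · have : χ y = 1 := χ.one_of_mem_closedBall (Metric.mem_closedBall.2 h.le)
          rw [this, sub_self, zero_mul, mul_zero]
          have := rieszKernel_nonneg (N := N) (α := α) (x - y)
          have := hρnn y
          positivity
        · have hxy : ‖x - y‖ = dist y x := by rw [dist_comm, dist_eq_norm]
          have hne : x - y ≠ 0 := norm_pos_iff.1 (by linarith)
          have hn : ‖x - y‖ ≤ 2 * ‖x' - y‖ := by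
            rw [Metric.mem_ball, dist_eq_norm] at hx'
            have := norm_sub_norm_le (x - y) (x - x')
            rw [sub_sub_sub_cancel_left, norm_sub_rev x x'] at this
            rw [norm_sub_rev x' y] at *
            linarith
          have h2 := rieszKernel_le_of_near (α := α) hN hα2 hne hn
          have h3 := rieszKernel_nonneg (N := N) (α := α) (x - y)
          have h4 := rieszKernel_nonneg (N := N) (α := α) (x' - y)
          have h5 : |k (x - y) - k (x' - y)| ≤ (1 + 2 ^ ((N : ℝ) - α)) * k (x - y) := by
            rw [abs_le]; constructor <;> nlinarith
          rw [← mul_assoc (1 + 2 ^ ((N : ℝ) - α))]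
          refine mul_le_mul h5 ?_ (mul_nonneg h1 (hρnn y)) ((abs_nonneg _).trans h5)
          exact mul_le_of_le_one_left (hρnn y) (by linarith [χ.nonneg (x := y)])
      · filter_upwards [ae_sub_ne_zero hN x] with y hy
        have h1 := (((tendsto_const_nhds (x := k (x - y))).sub
          (rieszKernel_sub_tendsto (α := α) hy)).abs).mul_const ((1 - χ y) * ρ y)
        simpa [← hk] using h1
    simpa using this
  have hnear := (tendsto_integral_abs_rieszKernel_sub_mul (α := α) hN hα1 hχc χ.hasCompactSupport
    (fun y => χ.nonneg) x).const_mul M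
  have hsum := hnear.add hfar
  simp only [mul_zero, add_zero] at hsum
  refine squeeze_zero (fun x' => integral_nonneg fun y => mul_nonneg (abs_nonneg _) (hρnn y))
    (fun x' => ?_) hsum
  have hfi : Integrable fun y => |k (x - y) - k (x' - y)| * ((1 - χ y) * ρ y) := by
    refine (hdi x').mono' ((hdm x').mul ((measurable_const.sub
          hχc.measurable).mul hρm)).aestronglyMeasurable (ae_of_all _ fun y => ?_)
    have h1 : 0 ≤ 1 - χ y := sub_nonneg.2 χ.le_one
    rw [Real.norm_of_nonneg (mul_nonneg (abs_nonneg _) (mul_nonneg h1 (hρnn y)))]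
    exact mul_le_mul_of_nonneg_left (mul_le_of_le_one_left (hρnn y)
      (by linarith [χ.nonneg (x := y)])) (abs_nonneg _)
  have hni : Integrable fun y => |k (x - y) - k (x' - y)| * χ y := by
    have h1 := (integrable_rieszKernel_sub_mul (α := α) hN hα1 hχc χ.hasCompactSupport x).sub
      (integrable_rieszKernel_sub_mul (α := α) hN hα1 hχc χ.hasCompactSupport x')
    refine h1.norm.congr (ae_of_all _ fun y => ?_)
    simp only [Pi.sub_apply]
    rw [← sub_mul, norm_mul, Real.norm_eq_abs, Real.norm_of_nonneg χ.nonneg]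
  rw [← hk, ← integral_const_mul, ← integral_add (hni.const_mul M) hfi]
  refine integral_mono (hdi x') ((hni.const_mul M).add hfi) fun y => ?_
  simp only
  have := mul_le_mul_of_nonneg_left (hM' y) (hd0 x' y)
  nlinarith

end

section
variable {N : ℕ} {α : ℝ}

/-- A bounded sequence of functions with a common modulus of continuity has a pointwise convergent
subsequence. -/
lemma exists_subseq_tendsto_of_modulus {X : Type*} [TopologicalSpace X]
    [TopologicalSpace.SeparableSpace X] [Nonempty X] {w : ℕ → X → ℝ} {C : ℝ}
    (hC : ∀ n x, w n x ∈ Set.Icc 0 C) {ω : X → X → ℝ} (hω : ∀ x, Tendsto (ω x) (𝓝 x) (𝓝 0))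
    (hw : ∀ n x x', |w n x - w n x'| ≤ ω x x') :
    ∃ ψ : ℕ → ℕ, StrictMono ψ ∧ ∃ v : X → ℝ, ∀ x, Tendsto (fun n => w (ψ n) x) atTop (𝓝 (v x)) := by
  have hK : IsCompact (Set.univ.pi fun _ : ℕ => Set.Icc (0 : ℝ) C) :=
    isCompact_univ_pi fun _ => isCompact_Icc
  obtain ⟨a, -, ψ, hψ, ha⟩ := hK.tendsto_subseq
    (x := fun n j => w n (TopologicalSpace.denseSeq X j)) fun n j _ => hC n _
  have ha' : ∀ j, CauchySeq fun n => w (ψ n) (TopologicalSpace.denseSeq X j) := fun j =>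
    ((tendsto_pi_nhds.1 ha) j).cauchySeq
  have hlim : ∀ x, ∃ l, Tendsto (fun n => w (ψ n) x) atTop (𝓝 l) := fun x => by
    refine cauchySeq_tendsto_of_complete (Metric.cauchySeq_iff.2 fun e he => ?_)
    have hev : ∀ᶠ x' in 𝓝 x, ω x x' < e / 3 := (hω x).eventually_lt_const (by positivity)
    obtain ⟨U, hU, hUo, hxU⟩ := eventually_nhds_iff.1 hev
    obtain ⟨j, hj⟩ := (TopologicalSpace.denseRange_denseSeq X).exists_mem_open hUo ⟨x, hxU⟩
    obtain ⟨M, hM⟩ := Metric.cauchySeq_iff.1 (ha' j) (e / 3) (by positivity)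
    refine ⟨M, fun m hm n hn => ?_⟩
    have h1 := hM m hm n hn
    have h2 := hU _ hj
    have h3 := hw (ψ m) x (TopologicalSpace.denseSeq X j)
    have h4 := hw (ψ n) x (TopologicalSpace.denseSeq X j)
    rw [Real.dist_eq, abs_lt] at *
    rw [abs_le] at h3 h4
    constructor <;> linarith [h1.1, h1.2, h3.1, h3.2, h4.1, h4.2]
  choose v hv using hlim
  exact ⟨ψ, hψ, v, hv⟩

lemma exists_integral_solution (hN : 3 ≤ N) (hα1 : 0 < α) (hα2 : α < 2)
    {ρ : 𝔼 N → ℝ} (hρm : Measurable ρ) (hρnn : ∀ x, 0 ≤ ρ x)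
    (hρlb : ∀ R : ℝ, ∃ M : ℝ, ∀ x : 𝔼 N, ‖x‖ ≤ R → ρ x ≤ M)
    (hi : ∀ x, Integrable fun y => rieszKernel N α (x - y) * ρ y) {S : ℝ}
    (hS : ∀ x, ∫ y, rieszKernel N α (x - y) * ρ y ≤ S) {Φ : ℝ → ℝ} (hc : Continuous Φ)
    (ha : Antitone Φ) {b : ℝ} (h0 : ∀ t, 0 ≤ Φ t) (hb : ∀ t, Φ t ≤ b) :
    ∃ w : 𝔼 N → ℝ, Continuous w ∧ (∀ x, 0 ≤ w x) ∧ (∀ x, w x ≤ b * S) ∧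
      ∀ x, w x = ∫ y, ρ y * Φ (w y) * rieszKernel N α (x - y) := by
  have hN' : (3 : ℝ) ≤ N := by exact_mod_cast hN
  set k := rieszKernel N α with hk
  set s : ℝ := ((N : ℝ) - α) / 2 with hs
  have hb0 : 0 ≤ b := (h0 0).trans (hb 0)
  have hδ : ∀ n : ℕ, (0 : ℝ) < 1 / ((n : ℝ) + 1) := fun n => by positivity
  choose w g hwc hgc hg hwe using fun n : ℕ =>
    exists_approximate_solution hN hα2 hρm hρnn hρlb hc ha h0 hb (hδ n) n
  set q : ℕ → 𝔼 N → ℝ := fun n => (Metric.closedBall 0 (n : ℝ)).indicator ρ with hq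
  have hq0 : ∀ n y, 0 ≤ q n y := fun n y => Set.indicator_nonneg (fun x _ => hρnn x) y
  have hqρ : ∀ n y, q n y ≤ ρ y := fun n y => Set.indicator_le_self' (fun x _ => hρnn x) y
  have hqm : ∀ n, Measurable (q n) := fun n => hρm.indicator measurableSet_closedBall
  have hg0 : ∀ n t, 0 ≤ g n t := fun n t => (h0 _).trans (hg n t).1
  have hgb : ∀ n t, g n t ≤ b := fun n t => (hg n t).2.trans (hb t)
  have hqg : ∀ n y, q n y * g n (w n y) ≤ b * ρ y := fun n y => by
    rw [mul_comm b]
    exact mul_le_mul (hqρ n y) (hgb n _) (hg0 n _) (hρnn y)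
  have hfm : ∀ n x, Measurable fun y => q n y * g n (w n y) *
      regKernel N s (1 / ((n : ℝ) + 1)) (x - y) := fun n x =>
    ((hqm n).mul ((hgc n).comp (hwc n)).measurable).mul
      ((continuous_regKernel (hδ n)).comp (continuous_const.sub continuous_id)).measurable
  have hf0 : ∀ n x y, 0 ≤ q n y * g n (w n y) *
      regKernel N s (1 / ((n : ℝ) + 1)) (x - y) := fun n x y =>
    mul_nonneg (mul_nonneg (hq0 n y) (hg0 n _)) (regKernel_nonneg (hδ n).le _)
  have hfb : ∀ n x, ∀ᵐ y, q n y * g n (w n y) * regKernel N s (1 / ((n : ℝ) + 1)) (x - y) ≤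
      b * (k (x - y) * ρ y) := fun n x => by
    filter_upwards [ae_sub_ne_zero hN x] with y hy
    calc _ ≤ b * ρ y * k (x - y) := mul_le_mul (hqg n y)
          (regKernel_le_rieszKernel hN hα2 (hδ n).le hy) (regKernel_nonneg (hδ n).le _)
          (mul_nonneg hb0 (hρnn y))
      _ = _ := by ring
  have hfb' : ∀ n x, ∀ᵐ y, ‖q n y * g n (w n y) * regKernel N s (1 / ((n : ℝ) + 1)) (x - y)‖ ≤
      b * (k (x - y) * ρ y) := fun n x => by
    filter_upwards [hfb n x] with y hy
    rwa [Real.norm_of_nonneg (hf0 n x y)]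
  have hfi : ∀ n x, Integrable fun y => q n y * g n (w n y) *
      regKernel N s (1 / ((n : ℝ) + 1)) (x - y) := fun n x =>
    ((hi x).const_mul b).mono' (hfm n x).aestronglyMeasurable (hfb' n x)
  have hw0 : ∀ n x, 0 ≤ w n x := fun n x => by
    rw [hwe n x]
    exact integral_nonneg (hf0 n x)
  have hwS : ∀ n x, w n x ≤ b * S := fun n x => by
    rw [hwe n x]
    calc _ ≤ ∫ y, b * (k (x - y) * ρ y) :=
          integral_mono_ae (hfi n x) ((hi x).const_mul b) (hfb n x)
      _ = b * ∫ y, k (x - y) * ρ y := integral_const_mul _ _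
      _ ≤ _ := mul_le_mul_of_nonneg_left (hS x) hb0
  have hdi : ∀ x x', Integrable fun y => |k (x - y) - k (x' - y)| * ρ y := fun x x' => by
    refine ((hi x).sub (hi x')).norm.congr (ae_of_all _ fun y => ?_)
    simp only [Pi.sub_apply]
    rw [← sub_mul, norm_mul, Real.norm_eq_abs, Real.norm_of_nonneg (hρnn y)]
  have hmod : ∀ n x x', |w n x - w n x'| ≤ b * ∫ y, |k (x - y) - k (x' - y)| * ρ y :=
    fun n x x' => by
      rw [hwe n x, hwe n x', ← integral_sub (hfi n x) (hfi n x'), ← integral_const_mul,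
        ← Real.norm_eq_abs]
      refine norm_integral_le_of_norm_le ((hdi x x').const_mul b) ?_
      filter_upwards [ae_sub_ne_zero hN x, ae_sub_ne_zero hN x'] with y hy hy'
      rw [← mul_sub, norm_mul, Real.norm_of_nonneg (mul_nonneg (hq0 n y) (hg0 n _)),
        Real.norm_eq_abs]
      calc _ ≤ b * ρ y * |k (x - y) - k (x' - y)| := mul_le_mul (hqg n y)
            (abs_regKernel_sub_le hN hα2 (hδ n).le hy hy') (abs_nonneg _)
            (mul_nonneg hb0 (hρnn y))
        _ = _ := by ring
  have hω : ∀ x, Tendsto (fun x' => b * ∫ y, |k (x - y) - k (x' - y)| * ρ y) (𝓝 x) (𝓝 0) :=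
    fun x => by
      have := (tendsto_integral_abs_rieszKernel_sub hN hα1 hα2 hρm hρnn hρlb hi x).const_mul b
      rwa [mul_zero] at this
  obtain ⟨ψ, hψ, v, hv⟩ := exists_subseq_tendsto_of_modulus
    (fun n x => ⟨hw0 n x, hwS n x⟩) hω hmod
  have hvmod : ∀ x x', |v x - v x'| ≤ b * ∫ y, |k (x - y) - k (x' - y)| * ρ y := fun x x' =>
    le_of_tendsto (((hv x).sub (hv x')).abs) (Eventually.of_forall fun n => hmod _ x x')
  have hvc : Continuous v := by
    rw [continuous_iff_continuousAt]
    intro x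
    rw [ContinuousAt, tendsto_iff_dist_tendsto_zero]
    refine squeeze_zero (fun _ => dist_nonneg) (fun x' => ?_) (hω x)
    rw [dist_comm, Real.dist_eq]
    exact hvmod x x'
  refine ⟨v, hvc, fun x => ge_of_tendsto' (hv x) fun n => hw0 _ x,
    fun x => le_of_tendsto' (hv x) fun n => hwS _ x, fun x => ?_⟩
  refine tendsto_nhds_unique (hv x) ?_
  simp only [fun n => hwe (ψ n) x]
  have hδ0 : Tendsto (fun n => 1 / (((ψ n : ℕ) : ℝ) + 1)) atTop (𝓝 0) :=
    tendsto_one_div_add_atTop_nhds_zero_nat.comp hψ.tendsto_atTop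
  refine tendsto_integral_of_dominated_convergence (fun y => b * (k (x - y) * ρ y))
    (fun n => (hfm (ψ n) x).aestronglyMeasurable) ((hi x).const_mul b) (fun n => hfb' (ψ n) x) ?_
  filter_upwards [ae_sub_ne_zero hN x] with y hy
  refine (Tendsto.mul ?_ ?_).mul ?_
  · refine tendsto_const_nhds.congr' ?_
    obtain ⟨m, hm⟩ := exists_nat_ge ‖y‖
    filter_upwards [eventually_ge_atTop m] with n hn
    refine (Set.indicator_of_mem (mem_closedBall_zero_iff.2 (hm.trans ?_)) ρ).symm
    exact_mod_cast hn.trans hψ.le_apply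
  · have h1 : Tendsto (fun n => Φ (w (ψ n) y + 1 / (((ψ n : ℕ) : ℝ) + 1))) atTop (𝓝 (Φ (v y))) := by
      have := (hv y).add hδ0
      rw [add_zero] at this
      exact (hc.tendsto _).comp this
    have h2 : Tendsto (fun n => Φ (w (ψ n) y)) atTop (𝓝 (Φ (v y))) := (hc.tendsto _).comp (hv y)
    exact tendsto_of_tendsto_of_tendsto_of_le_of_le h1 h2 (fun n => (hg _ _).1) fun n => (hg _ _).2
  · rw [hk, rieszKernel_eq_rpow_sq]
    have hxy := norm_pos_iff.2 hy
    have h3 : Tendsto (fun n => ‖x - y‖ ^ 2 + 1 / (((ψ n : ℕ) : ℝ) + 1)) atTop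
        (𝓝 (‖x - y‖ ^ 2)) := by
      have := hδ0.const_add (‖x - y‖ ^ 2)
      rwa [add_zero] at this
    exact h3.rpow_const (Or.inl (by positivity))

end

section
variable {N : ℕ} {α : ℝ}

lemma integral_potential_mul_fracLap (hN : 3 ≤ N) (hα1 : 0 < α) (hα2 : α < 2) {c : ℝ}
    (hc : ∀ θ : 𝔼 N → ℝ, ContDiff ℝ (⊤ : ℕ∞) θ → HasCompactSupport θ →
      ∀ y, c * ∫ x, rieszKernel N α (x - y) * fracLap N α θ x = -θ y)
    {f w : 𝔼 N → ℝ} (hf : Measurable f) (hf0 : ∀ y, 0 ≤ f y)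
    (hi : ∀ x, Integrable fun y => c * f y * rieszKernel N α (x - y)) (hwc : Continuous w)
    {B : ℝ} (hB : ∀ x, |w x| ≤ B) (hc0 : 0 ≤ c)
    (hw : ∀ x, w x = ∫ y, c * f y * rieszKernel N α (x - y)) {θ : 𝔼 N → ℝ}
    (hθ : ContDiff ℝ (⊤ : ℕ∞) θ) (hθc : HasCompactSupport θ) :
    Integrable (fun x => w x * fracLap N α θ x) ∧
      ∫ x, w x * fracLap N α θ x = -∫ y, f y * θ y := by
  have hL := integrable_fracLap hN hα1 hα2 hθ hθc
  have hLc := continuous_fracLap hN hα1 hα2 hθ hθc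
  have hwL : Integrable fun x => w x * fracLap N α θ x :=
    hL.bdd_mul hwc.aestronglyMeasurable (ae_of_all _ hB)
  refine ⟨hwL, ?_⟩
  have hm : Measurable fun p : 𝔼 N × 𝔼 N =>
      c * f p.2 * rieszKernel N α (p.1 - p.2) * fracLap N α θ p.1 :=
    ((measurable_const.mul (hf.comp measurable_snd)).mul
      (measurable_rieszKernel.comp (measurable_fst.sub measurable_snd))).mul
      (hLc.measurable.comp measurable_fst)
  have hp : Integrable (fun p : 𝔼 N × 𝔼 N =>
      c * f p.2 * rieszKernel N α (p.1 - p.2) * fracLap N α θ p.1) (volume.prod volume) := by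
    rw [integrable_prod_iff hm.aestronglyMeasurable]
    refine ⟨ae_of_all _ fun x => (hi x).mul_const (fracLap N α θ x), hwL.norm.congr (ae_of_all _ fun x => ?_)⟩
    simp only [norm_mul _ (fracLap N α θ x)]
    rw [integral_mul_const]
    congr 1
    rw [hw x, Real.norm_of_nonneg (integral_nonneg fun y =>
      mul_nonneg (mul_nonneg hc0 (hf0 y)) (rieszKernel_nonneg _))]
    refine integral_congr_ae (ae_of_all _ fun y => ?_)
    exact (Real.norm_of_nonneg (mul_nonneg (mul_nonneg hc0 (hf0 y)) (rieszKernel_nonneg _))).symm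
  calc ∫ x, w x * fracLap N α θ x
      = ∫ x, ∫ y, c * f y * rieszKernel N α (x - y) * fracLap N α θ x := by
        refine integral_congr_ae (ae_of_all _ fun x => ?_)
        simp only
        rw [integral_mul_const, ← hw x]
    _ = ∫ y, ∫ x, c * f y * rieszKernel N α (x - y) * fracLap N α θ x :=
        integral_integral_swap hp
    _ = ∫ y, -(f y * θ y) := by
        refine integral_congr_ae (ae_of_all _ fun y => ?_)
        simp only [mul_assoc (c * f y)]
        rw [integral_const_mul, mul_comm c, mul_assoc, hc θ hθ hθc y]
        ring
    _ = _ := integral_neg _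

lemma exists_solution_of_potential_bounded (hN : 3 ≤ N) (hα1 : 0 < α) (hα2 : α < 2)
    {ρ : 𝔼 N → ℝ} (hρm : Measurable ρ) (hρnn : ∀ x, 0 ≤ ρ x)
    (hρlb : ∀ R : ℝ, ∃ M : ℝ, ∀ x : 𝔼 N, ‖x‖ ≤ R → ρ x ≤ M) {φ : ℝ → ℝ≥0∞}
    (hφc : ContinuousOn φ (Set.Ioi 0)) (hφanti : AntitoneOn φ (Set.Ioi 0))
    (hφpos : ∀ t : ℝ, 0 < t → 0 < φ t ∧ φ t < ⊤)
    (hsup : (⨆ x : 𝔼 N, ∫⁻ y, ENNReal.ofReal (ρ y * ‖x - y‖ ^ (-((N : ℝ) - α)))) < ⊤) :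
    ∃ u : 𝔼 N → ℝ, NegEntireSol N α ρ φ u := by
  obtain ⟨c, hc0, hc⟩ := exists_fundamental_const hN hα1 hα2
  set P := ⨆ x : 𝔼 N, ∫⁻ y, ENNReal.ofReal (ρ y * ‖x - y‖ ^ (-((N : ℝ) - α))) with hP
  have hle : ∀ x, ∫⁻ y, ENNReal.ofReal (rieszKernel N α (x - y) * ρ y) ≤ P := fun x => by
    simp only [mul_comm (rieszKernel N α _)]
    exact le_iSup (fun x : 𝔼 N => ∫⁻ y, ENNReal.ofReal (ρ y * ‖x - y‖ ^ (-((N : ℝ) - α)))) x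
  have hkm : ∀ x, Measurable fun y => rieszKernel N α (x - y) * ρ y := fun x =>
    (measurable_rieszKernel.comp (measurable_const.sub measurable_id)).mul hρm
  have hk0 : ∀ x y, 0 ≤ rieszKernel N α (x - y) * ρ y := fun x y =>
    mul_nonneg (rieszKernel_nonneg _) (hρnn y)
  have hi : ∀ x, Integrable fun y => rieszKernel N α (x - y) * ρ y := fun x => by
    refine ⟨(hkm x).aestronglyMeasurable, ?_⟩
    rw [hasFiniteIntegral_iff_ofReal (ae_of_all _ (hk0 x))]
    exact (hle x).trans_lt hsup
  have hS : ∀ x, ∫ y, rieszKernel N α (x - y) * ρ y ≤ P.toReal := fun x => by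
    rw [integral_eq_lintegral_of_nonneg_ae (ae_of_all _ (hk0 x)) (hkm x).aestronglyMeasurable]
    exact ENNReal.toReal_mono hsup.ne (hle x)
  have hpos : ∀ t : ℝ, 0 < 1 + max t 0 := fun t => by positivity
  set F : ℝ → ℝ := fun t => (φ (1 + max t 0)).toReal with hF
  have hFc : Continuous F := by
    have h1 : Continuous fun t : ℝ => φ (1 + max t 0) :=
      hφc.comp_continuous (by fun_prop) hpos
    exact ENNReal.continuousOn_toReal.comp_continuous h1 fun t => (hφpos _ (hpos t)).2.ne
  have hFa : Antitone F := fun s t hst => ENNReal.toReal_mono (hφpos _ (hpos s)).2.ne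
    (hφanti (hpos s) (hpos t) (by gcongr))
  have hF0 : ∀ t, 0 ≤ F t := fun t => ENNReal.toReal_nonneg
  have hFb : ∀ t, F t ≤ F 0 := fun t => by
    rcases le_total 0 t with h | h
    · exact hFa h
    · simp [hF, max_eq_right h]
  obtain ⟨w, hwc, hw0, hwb, hw⟩ := exists_integral_solution hN hα1 hα2 hρm hρnn hρlb hi hS
    (hFc.const_mul c) (fun s t h => mul_le_mul_of_nonneg_left (hFa h) hc0.le)
    (fun t => mul_nonneg hc0.le (hF0 t)) (fun t => mul_le_mul_of_nonneg_left (hFb t) hc0.le)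
  have hFw : ∀ x, F (w x) = (φ (1 + w x)).toReal := fun x => by
    simp only [hF, max_eq_left (hw0 x)]
  set f : 𝔼 N → ℝ := fun y => ρ y * F (w y) with hf
  have hfm : Measurable f := hρm.mul (hFc.comp hwc).measurable
  have hfe : ∀ y, ENNReal.ofReal (ρ y) * φ (1 + w y) = ENNReal.ofReal (f y) := fun y => by
    rw [hf, ENNReal.ofReal_mul (hρnn y), hFw, ENNReal.ofReal_toReal]
    exact (hφpos _ (by have := hw0 y; positivity)).2.ne
  have hf0 : ∀ y, 0 ≤ f y := fun y => mul_nonneg (hρnn y) (hF0 _)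
  have hfi : ∀ x, Integrable fun y => c * f y * rieszKernel N α (x - y) := fun x => by
    refine ((hi x).const_mul (c * F 0)).mono' ((measurable_const.mul hfm).mul
      (measurable_rieszKernel.comp (measurable_const.sub measurable_id))).aestronglyMeasurable
      (ae_of_all _ fun y => ?_)
    rw [Real.norm_of_nonneg (mul_nonneg (mul_nonneg hc0.le (hf0 y)) (rieszKernel_nonneg _))]
    have h1 := mul_le_mul_of_nonneg_left (hFb (w y)) (mul_nonneg hc0.le (hk0 x y))
    simp only [hf]
    linarith
  refine ⟨fun x => 1 + w x, continuous_const.add hwc, ⟨1 + c * F 0 * P.toReal,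
    fun x => by linarith [hwb x]⟩, fun x => by linarith [hw0 x], fun K hK => ?_,
    fun θ hθ hθc => ?_⟩
  · simp only [hfe]
    obtain ⟨R, hR⟩ := hK.isBounded.subset_closedBall 0
    obtain ⟨M, hM⟩ := hρlb R
    refine ne_top_of_le_ne_top ?_ (setLIntegral_mono (g := fun _ => ENNReal.ofReal (M * F 0))
      measurable_const fun y hy => ENNReal.ofReal_le_ofReal ?_)
    · rw [setLIntegral_const]
      exact ENNReal.mul_ne_top ENNReal.ofReal_ne_top hK.measure_lt_top.ne
    · have h1 := hM y (mem_closedBall_zero_iff.1 (hR hy))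
      exact mul_le_mul h1 (hFb _) (hF0 _) ((hρnn y).trans h1)
  · simp only [hfe, ENNReal.toReal_ofReal (hf0 _)]
    obtain ⟨h1, h2⟩ := integral_potential_mul_fracLap hN hα1 hα2 hc hfm hf0 hfi hwc
      (fun x => by rw [abs_of_nonneg (hw0 x)]; exact hwb x) hc0.le
      (fun x => by
        rw [hw x]
        refine integral_congr_ae (ae_of_all _ fun y => ?_)
        simp only [hf]
        ring) hθ hθc
    simp only [add_mul, one_mul]
    rw [integral_add (integrable_fracLap hN hα1 hα2 hθ hθc) h1,
      integral_fracLap hN hα1 hα2 hθ hθc, zero_add, h2]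

end

/-- `-Δ^{α/2}u = ρ·φ(u)` (with `φ` positive and nonincreasing on `(0,∞)`)
admits a nonnegative entire bounded solution iff `ρ` is potentially bounded. -/
theorem stmt16 (N : ℕ) (hN : 3 ≤ N) (α : ℝ) (hα1 : 0 < α) (hα2 : α < 2)
    (ρ : EuclideanSpace ℝ (Fin N) → ℝ) (hρm : Measurable ρ) (hρnn : ∀ x, 0 ≤ ρ x)
    (hρlb : ∀ R : ℝ, ∃ M : ℝ, ∀ x : EuclideanSpace ℝ (Fin N), ‖x‖ ≤ R → ρ x ≤ M)
    (hρnt : 0 < volume {x : EuclideanSpace ℝ (Fin N) | 0 < ρ x})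
    (φ : ℝ → ℝ≥0∞)
    (hφc : ContinuousOn φ (Set.Ioi 0)) (hφanti : AntitoneOn φ (Set.Ioi 0))
    (hφpos : ∀ t : ℝ, 0 < t → 0 < φ t ∧ φ t < ⊤)
    (hφ0 : Tendsto φ (nhdsWithin 0 (Set.Ioi 0)) (nhds (φ 0))) (hφ0pos : 0 < φ 0) :
    (∃ u : EuclideanSpace ℝ (Fin N) → ℝ, NegEntireSol N α ρ φ u) ↔
    (⨆ x : EuclideanSpace ℝ (Fin N),
      ∫⁻ y, ENNReal.ofReal (ρ y * ‖x - y‖ ^ (-((N : ℝ) - α)))) < ⊤ := by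
  exact
    ⟨fun ⟨_, hu⟩ => potential_bounded_of_solution hN hα1 hα2 hρm hρnn hφanti hφpos hφ0 hu,
      exists_solution_of_potential_bounded hN hα1 hα2 hρm hρnn hρlb hφc hφanti hφpos⟩
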